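/- Let $m > 2$ be an integer, $\Omega = \{|x|>1\}$, $Q_0$ the ground state stationary solution. Suppose $(u_0,u_1) \in \dot H^1_0(\Omega)\times L^2(\Omega)$ is radial with $E(u_0,u_1) \leq E(Q_0,0)$ and $\int_\Omega |\nabla u_0|^2 = \int_\Omega |\nabla Q_0|^2$. Then $u_1 = 0$ and $u_0 = \pm Q_0$. -/

import Mathlib

open MeasureTheory Real Set Filter

/-- Radial profiles of functions in `Ḣ¹₀(Ω)`, `Ω = {|x| > 1} ⊂ ℝ³`,
with finite `L^{2(m+1)}` norm. -/
def RadialH10 (m : ℕ) (f : ℝ → ℝ) : Prop :=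
  ContinuousOn f (Ici 1) ∧ f 1 = 0 ∧ DifferentiableOn ℝ f (Ioi 1) ∧
  Tendsto f atTop (nhds 0) ∧
  IntegrableOn (fun r => (deriv f r)^2 * r^2) (Ioi 1) ∧
  IntegrableOn (fun r => |f r| ^ (2 * (m + 1)) * r^2) (Ioi 1)

/-- The conserved energy
`E(u₀,u₁) = ½∫_Ω |∇u₀|² + ½∫_Ω u₁² - (1/(2(m+1)))∫_Ω |u₀|^{2(m+1)}`
in radial coordinates on `Ω = {|x| > 1} ⊂ ℝ³`. -/
noncomputable def energyRad (m : ℕ) (u0 u1 : ℝ → ℝ) : ℝ :=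
  4 * π * ((1/2) * (∫ r in Ioi 1, (deriv u0 r)^2 * r^2)
    + (1/2) * (∫ r in Ioi 1, (u1 r)^2 * r^2)
    - (1 / (2 * ((m : ℝ) + 1))) * ∫ r in Ioi 1, |u0 r| ^ (2 * (m + 1)) * r^2)

theorem strictAntiOn_Ioi_of_hasDerivAt_neg {f f' : ℝ → ℝ} {a : ℝ}
    (h : ∀ r, a < r → HasDerivAt f (f' r) r) (hneg : ∀ r, a < r → f' r < 0) :
    StrictAntiOn f (Ioi a) := by
  apply strictAntiOn_of_hasDerivWithinAt_neg (convex_Ioi a) (f' := f')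
  · exact fun x hx => (h x hx).continuousAt.continuousWithinAt
  · intro x hx
    rw [interior_Ioi] at hx
    exact (h x hx).hasDerivWithinAt
  · intro x hx
    rw [interior_Ioi] at hx
    exact hneg x hx

/-- A strictly decreasing function on `(a, ∞)` lies strictly above its limit at infinity. -/
theorem StrictAntiOn.lt_of_tendsto_atTop {f : ℝ → ℝ} {a l : ℝ} (h : StrictAntiOn f (Ioi a))
    (hl : Tendsto f atTop (nhds l)) {r : ℝ} (hr : a < r) : l < f r := by
  have h1 : l ≤ f (r + 1) := by
    refine le_of_tendsto hl ?_
    filter_upwards [eventually_gt_atTop (r + 1)] with x hx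
    have := h (show r + 1 ∈ Ioi a by simp; linarith) (show x ∈ Ioi a by simp; linarith) hx
    exact this.le
  have h2 := h (show r ∈ Ioi a from hr) (show r + 1 ∈ Ioi a by simp; linarith) (by linarith)
  linarith

theorem integral_Ioi_eq_sub {F : ℝ → ℝ} (hF : IntegrableOn F (Ioi 1)) {r : ℝ} (hr : 1 ≤ r) :
    ∫ t in Ioi r, F t = (∫ t in Ioi 1, F t) - ∫ t in (1:ℝ)..r, F t := by
  rw [← intervalIntegral.integral_Ioi_sub_Ioi hF hr]; ring

theorem continuousOn_integral_Ioi {F : ℝ → ℝ} (hF : IntegrableOn F (Ioi 1)) :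
    ContinuousOn (fun r => ∫ t in Ioi r, F t) (Ici 1) := by
  have h1 : ContinuousOn (fun r => (∫ t in Ioi 1, F t) - ∫ t in (1:ℝ)..r, F t) (Ici 1) := by
    apply continuousOn_const.sub
    intro x hx
    have hx' : (1:ℝ) ≤ x := hx
    have h2 : ContinuousOn (fun r => ∫ t in (1:ℝ)..r, F t) (uIcc 1 (x + 1)) := by
      apply intervalIntegral.continuousOn_primitive_interval
      rw [uIcc_of_le (by linarith), integrableOn_Icc_iff_integrableOn_Ioc]
      exact hF.mono_set Ioc_subset_Ioi_self
    rw [uIcc_of_le (by linarith)] at h2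
    refine (h2 x ⟨hx', by linarith⟩).mono_of_mem_nhdsWithin ?_
    rw [← Ici_inter_Iic]
    exact inter_mem self_mem_nhdsWithin (mem_nhdsWithin_of_mem_nhds (Iic_mem_nhds (by linarith)))
  exact h1.congr fun r hr => integral_Ioi_eq_sub hF hr

theorem tendsto_integral_Ioi_zero {F : ℝ → ℝ} (hF : IntegrableOn F (Ioi 1)) :
    Tendsto (fun r => ∫ t in Ioi r, F t) atTop (nhds 0) := by
  have h := (intervalIntegral_tendsto_integral_Ioi 1 hF tendsto_id).const_sub (∫ t in Ioi 1, F t)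
  rw [sub_self] at h
  refine h.congr' ?_
  filter_upwards [eventually_ge_atTop 1] with r hr
  exact (integral_Ioi_eq_sub hF hr).symm

theorem hasDerivAt_integral_Ioi {F : ℝ → ℝ} (hF : IntegrableOn F (Ioi 1))
    (hc : ContinuousOn F (Ioi 1)) {r : ℝ} (hr : 1 < r) :
    HasDerivAt (fun r => ∫ t in Ioi r, F t) (-F r) r := by
  have h : HasDerivAt (fun r => ∫ t in (1:ℝ)..r, F t) (F r) r := by
    apply intervalIntegral.integral_hasDerivAt_right
    · rw [intervalIntegrable_iff_integrableOn_Ioc_of_le hr.le]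
      exact hF.mono_set Ioc_subset_Ioi_self
    · exact hc.stronglyMeasurableAtFilter isOpen_Ioi r hr
    · exact hc.continuousAt (Ioi_mem_nhds hr)
  refine (h.const_sub (∫ t in Ioi 1, F t)).congr_of_eventuallyEq ?_
  filter_upwards [Ioi_mem_nhds hr] with x hx
  exact integral_Ioi_eq_sub hF (le_of_lt hx)

/-- Radial decay estimate: `r |f(r)|² ≤ ∫_r^∞ |f'|² t² dt`. -/
theorem mul_sq_le_integral_Ioi {f f' : ℝ → ℝ} (hf : ∀ r, 1 < r → HasDerivAt f (f' r) r)
    (hlim : Tendsto f atTop (nhds 0))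
    (hint : IntegrableOn (fun r => f' r ^ 2 * r ^ 2) (Ioi 1)) {r : ℝ} (hr : 1 < r) :
    r * f r ^ 2 ≤ ∫ t in Ioi r, f' t ^ 2 * t ^ 2 := by
  have key : ∀ R, r < R → r * (f r - f R) ^ 2 ≤ ∫ t in Ioi r, f' t ^ 2 * t ^ 2 := by
    intro R hR
    have hfc : ∀ x, r ≤ x → HasDerivAt (fun t => -(t * (f t - f R) ^ 2))
        (-(1 * (f x - f R) ^ 2 + x * (2 * (f x - f R) * f' x))) x := by
      intro x hx
      have h1 := (hf x (by linarith)).sub_const (f R)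
      have h2 := ((hasDerivAt_id x).mul (h1.pow 2)).neg
      refine h2.congr_deriv ?_
      simp
    have h := intervalIntegral.sub_le_integral_of_hasDeriv_right_of_le hR.le
      (g := fun t => -(t * (f t - f R) ^ 2))
      (g' := fun x => -(1 * (f x - f R) ^ 2 + x * (2 * (f x - f R) * f' x)))
      (φ := fun t => f' t ^ 2 * t ^ 2)
      (fun x hx => (hfc x hx.1).continuousAt.continuousWithinAt)
      (fun x hx => (hfc x hx.1.le).hasDerivWithinAt)
      (hint.mono_set fun x hx => lt_of_lt_of_le hr hx.1)
      (fun x hx => by nlinarith [sq_nonneg (x * f' x + (f x - f R))])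
    have h3 : ∫ t in r..R, f' t ^ 2 * t ^ 2 ≤ ∫ t in Ioi r, f' t ^ 2 * t ^ 2 := by
      rw [intervalIntegral.integral_of_le hR.le]
      apply setIntegral_mono_set (hint.mono_set (Ioi_subset_Ioi hr.le))
      · exact ae_of_all _ fun x => by positivity
      · exact Ioc_subset_Ioi_self.eventuallyLE
    simp only [sub_self] at h
    linarith
  have hl : Tendsto (fun R => r * (f r - f R) ^ 2) atTop (nhds (r * (f r - 0) ^ 2)) :=
    ((hlim.const_sub (f r)).pow 2).const_mul r
  rw [sub_zero] at hl
  refine le_of_tendsto hl ?_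
  filter_upwards [eventually_gt_atTop r] with R hR using key R hR

theorem tendsto_mul_sq_atTop {f f' : ℝ → ℝ} (hf : ∀ r, 1 < r → HasDerivAt f (f' r) r)
    (hlim : Tendsto f atTop (nhds 0))
    (hint : IntegrableOn (fun r => f' r ^ 2 * r ^ 2) (Ioi 1)) :
    Tendsto (fun r => r * f r ^ 2) atTop (nhds 0) := by
  refine tendsto_of_tendsto_of_tendsto_of_le_of_le' tendsto_const_nhds
    (tendsto_integral_Ioi_zero hint) ?_ ?_
  · filter_upwards [eventually_gt_atTop 1] with r hr
    positivity
  · filter_upwards [eventually_gt_atTop 1] with r hr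
    exact mul_sq_le_integral_Ioi hf hlim hint hr

/-- Inverse of a positive decreasing function on `(1, ∞)` that blows up at `1`. -/
theorem exists_inverse_of_hasDerivAt_neg {H H' : ℝ → ℝ}
    (hH : ∀ r, 1 < r → HasDerivAt H (H' r) r) (hneg : ∀ r, 1 < r → H' r < 0)
    (hpos : ∀ r, 1 < r → 0 < H r) (hinf : Tendsto H (nhdsWithin 1 (Ioi 1)) atTop) :
    ∃ (c : ℝ) (T : ℝ → ℝ), 0 ≤ c ∧ (∀ x, c < x → 1 < T x ∧ H (T x) = x) ∧
      (∀ r, 1 < r → c < H r ∧ T (H r) = r) ∧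
      (∀ x, c < x → HasDerivAt T (H' (T x))⁻¹ x) ∧
      Tendsto T (nhdsWithin c (Ioi c)) atTop ∧
      Tendsto T atTop (nhdsWithin 1 (Ioi 1)) := by
  have hanti := strictAntiOn_Ioi_of_hasDerivAt_neg hH hneg
  have hcont : ContinuousOn H (Ioi 1) := fun x hx =>
    (hH x hx).continuousAt.continuousWithinAt
  set c := sInf (H '' Ioi 1) with hc
  have hbdd : BddBelow (H '' Ioi 1) := ⟨0, by rintro _ ⟨r, hr, rfl⟩; exact (hpos r hr).le⟩
  have hne : (H '' Ioi 1).Nonempty := ⟨H 2, 2, by simp, rfl⟩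
  have hc0 : 0 ≤ c := le_csInf hne (by rintro _ ⟨r, hr, rfl⟩; exact (hpos r hr).le)
  have hcH : ∀ r, 1 < r → c < H r := by
    intro r hr
    have h1 : c ≤ H (r + 1) := csInf_le hbdd ⟨r + 1, by simp; linarith, rfl⟩
    have h2 := hanti (show r ∈ Ioi 1 from hr) (show r + 1 ∈ Ioi 1 by simp; linarith)
      (by linarith)
    linarith
  have hsurj : ∀ x, c < x → ∃ r, 1 < r ∧ H r = x := by
    intro x hx
    obtain ⟨_, ⟨r1, hr1, rfl⟩, h1⟩ := exists_lt_of_csInf_lt hne hx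
    obtain ⟨r2, h2, hr2⟩ := ((hinf.eventually (eventually_gt_atTop x)).and
      self_mem_nhdsWithin).exists
    obtain ⟨r, hr, hrx⟩ := isPreconnected_Ioi.intermediate_value hr1 hr2 hcont ⟨h1.le, h2.le⟩
    exact ⟨r, hr, hrx⟩
  choose! T hT using hsurj
  have hTH : ∀ r, 1 < r → T (H r) = r := fun r hr =>
    hanti.injOn (hT _ (hcH r hr)).1 hr (hT _ (hcH r hr)).2
  have hTanti : ∀ x y, c < x → x < y → T y < T x := by
    intro x y hx hxy
    by_contra! hle
    have := hanti.antitoneOn (hT x hx).1 (hT y (hx.trans hxy)).1 hle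
    rw [(hT x hx).2, (hT y (hx.trans hxy)).2] at this
    linarith
  have hTcont : ∀ x, c < x → ContinuousAt T x := by
    intro x hx
    have hm : MonotoneOn (fun x => -T x) (Ioi c) := by
      intro a ha b hb hab
      rcases hab.eq_or_lt with rfl | hlt
      · exact le_rfl
      · exact neg_le_neg (hTanti a b ha hlt).le
    have h : ContinuousAt (fun x => -T x) x := by
      apply continuousAt_of_monotoneOn_of_image_mem_nhds hm (Ioi_mem_nhds hx)
      have : Iio (-1 : ℝ) ⊆ (fun x => -T x) '' Ioi c := by
        intro y hy
        have hy' : 1 < -y := by simp at hy; linarith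
        exact ⟨H (-y), hcH _ hy', by simp [hTH _ hy']⟩
      exact mem_of_superset (Iio_mem_nhds (by linarith [(hT x hx).1])) this
    have e : -(fun x => -T x) = T := by ext; simp
    have h2 := h.neg
    rwa [e] at h2
  refine ⟨c, T, hc0, hT, fun r hr => ⟨hcH r hr, hTH r hr⟩, fun x hx => ?_, ?_, ?_⟩
  · exact HasDerivAt.of_local_left_inverse (hTcont x hx) (hH _ (hT x hx).1)
      (hneg _ (hT x hx).1).ne (by filter_upwards [Ioi_mem_nhds hx] with y hy using (hT y hy).2)
  · rw [tendsto_atTop]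
    intro M
    have hM : 1 < max M 2 := lt_of_lt_of_le (by norm_num) (le_max_right _ _)
    filter_upwards [Ioo_mem_nhdsGT (hcH _ hM)] with x hx
    have := hTanti x _ hx.1 hx.2
    rw [hTH _ hM] at this
    exact (le_max_left _ _).trans this.le
  · apply tendsto_nhdsWithin_of_tendsto_nhds_of_eventually_within
    · rw [tendsto_order]
      refine ⟨fun a ha => ?_, fun a ha => ?_⟩
      · filter_upwards [eventually_gt_atTop c] with x hx
        exact ha.trans (hT x hx).1
      · filter_upwards [eventually_gt_atTop (H a)] with x hx
        have := hTanti _ x (hcH a ha) hx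
        rwa [hTH a ha] at this
    · filter_upwards [eventually_gt_atTop c] with x hx using (hT x hx).1

/-- A positive decaying radial solution `Q` of `-ΔQ = Q^(2m+1)` on `{r > 1}`, with radial
derivative `q` and tail integral `B(r) = ∫_r^∞ Q^(2m+2) t² dt`. -/
structure IsGroundProfile (m : ℕ) (Q q B : ℝ → ℝ) : Prop where
  two_lt : 2 < m
  hasDerivAt : ∀ r, 1 < r → HasDerivAt Q (q r) r
  hasDerivAt_deriv : ∀ r, 1 < r → HasDerivAt q (-(2 / r * q r) - Q r ^ (2 * m + 1)) r
  pos : ∀ r, 1 < r → 0 < Q r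
  hasDerivAt_tail : ∀ r, 1 < r → HasDerivAt B (-(Q r ^ (2 * m + 2) * r ^ 2)) r
  tendsto_zero : Tendsto Q atTop (nhds 0)
  tendsto_tail : Tendsto B atTop (nhds 0)
  decay : Tendsto (fun r => r * Q r ^ 2) atTop (nhds 0)

namespace IsGroundProfile

variable {m : ℕ} {Q q B : ℝ → ℝ}

theorem tail_pos (h : IsGroundProfile m Q q B) {r : ℝ} (hr : 1 < r) : 0 < B r := by
  refine (strictAntiOn_Ioi_of_hasDerivAt_neg h.hasDerivAt_tail ?_).lt_of_tendsto_atTop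
    h.tendsto_tail hr
  intro x hx
  have := h.pos x hx
  have : 0 < x := by linarith
  have : 0 < Q x ^ (2 * m + 2) * x ^ 2 := by positivity
  linarith

theorem hasDerivAt_flux (h : IsGroundProfile m Q q B) {r : ℝ} (hr : 1 < r) :
    HasDerivAt (fun r => r ^ 2 * q r) (-(r ^ 2 * Q r ^ (2 * m + 1))) r := by
  have hr0 : r ≠ 0 := by positivity
  refine ((hasDerivAt_pow 2 r).mul (h.hasDerivAt_deriv r hr)).congr_deriv ?_
  field_simp
  push_cast
  ring

theorem strictAntiOn_flux (h : IsGroundProfile m Q q B) :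
    StrictAntiOn (fun r => r ^ 2 * q r) (Ioi 1) := by
  refine strictAntiOn_Ioi_of_hasDerivAt_neg (fun r hr => h.hasDerivAt_flux hr) ?_
  intro x hx
  have := h.pos x hx
  have : 0 < x := by linarith
  have : 0 < x ^ 2 * Q x ^ (2 * m + 1) := by positivity
  linarith

theorem tendsto_flux (h : IsGroundProfile m Q q B) :
    ∃ l, 0 < l ∧ Tendsto (fun r => r ^ 2 * q r) atTop (nhds (-l)) := by
  obtain ⟨r₀, hr₀⟩ := eventually_atTop.mp
    (h.decay.eventually (eventually_lt_nhds (show (0:ℝ) < 1 by norm_num)))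
  set a := max r₀ 2 with ha
  have ha2 : 2 ≤ a := le_max_right _ _
  have hlow : ∀ r, a ≤ r → a ^ 2 * q a - 2 ≤ r ^ 2 * q r := by
    intro r hr
    have hmono : MonotoneOn (fun r => r ^ 2 * q r - 2 * (√r)⁻¹) (Ici a) := by
      have hd : ∀ x, a ≤ x → HasDerivAt (fun r => r ^ 2 * q r - 2 * (√r)⁻¹)
          (-(x ^ 2 * Q x ^ (2 * m + 1)) - 2 * (-(1 / (2 * √x)) / (√x) ^ 2)) x := by
        intro x hx
        have hx0 : 0 < x := by linarith
        exact (h.hasDerivAt_flux (by linarith)).sub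
          (((hasDerivAt_sqrt hx0.ne').inv (by positivity)).const_mul 2)
      apply monotoneOn_of_hasDerivWithinAt_nonneg (convex_Ici a)
        (f' := fun x => -(x ^ 2 * Q x ^ (2 * m + 1)) - 2 * (-(1 / (2 * √x)) / (√x) ^ 2))
      · exact fun x hx => (hd x hx).continuousAt.continuousWithinAt
      · intro x hx
        rw [interior_Ici] at hx
        exact (hd x (le_of_lt hx)).hasDerivWithinAt
      · intro x hx
        rw [interior_Ici] at hx
        have hx : a < x := hx
        have hx1 : 1 < x := by linarith
        have hx0 : 0 < x := by linarith
        have hQ := h.pos x hx1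
        have hs : 0 < √x := sqrt_pos.mpr hx0
        have hlt := hr₀ x ((le_max_left _ _).trans hx.le)
        have hsq : √x ^ 2 = x := sq_sqrt hx0.le
        set s := √x with hsdef
        have hsQ : s * Q x ≤ 1 := by
          have : (s * Q x) ^ 2 ≤ 1 := by rw [mul_pow, hsq]; exact hlt.le
          exact (sq_le_one_iff₀ (by positivity)).mp this
        obtain ⟨k, rfl⟩ : ∃ k, m = k + 3 := ⟨m - 3, by have := h.two_lt; omega⟩
        have h1 : (s * Q x) ^ (2 * (k + 3) + 1) ≤ 1 := pow_le_one₀ (by positivity) hsQ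
        have hs1 : 1 ≤ s := by
          rw [hsdef]; exact one_le_sqrt.mpr hx1.le
        have h2 : 1 ≤ s ^ (2 * k) := one_le_pow₀ hs1
        have h3 : s ^ 7 * Q x ^ (2 * (k + 3) + 1) ≤ 1 := by
          refine le_trans ?_ h1
          rw [mul_pow]
          exact mul_le_mul_of_nonneg_right (pow_le_pow_right₀ hs1 (by omega)) (by positivity)
        have h4 : x ^ 2 * Q x ^ (2 * (k + 3) + 1) ≤ 1 / s ^ 3 := by
          rw [le_div_iff₀ (by positivity), show x ^ 2 = s ^ 4 by rw [← hsq]; ring]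
          linarith [show s ^ 4 * Q x ^ (2 * (k + 3) + 1) * s ^ 3
            = s ^ 7 * Q x ^ (2 * (k + 3) + 1) by ring]
        have h5 : 2 * (-(1 / (2 * s)) / s ^ 2) = -(1 / s ^ 3) := by field_simp
        rw [h5]; linarith
    have h1 := hmono self_mem_Ici (show r ∈ Ici a from hr) hr
    have h2 : (√a)⁻¹ ≤ 1 := inv_le_one_of_one_le₀ (one_le_sqrt.mpr (by linarith))
    have h3 : 0 ≤ (√r)⁻¹ := by positivity
    simp only at h1
    linarith
  have hlim : ∃ L, Tendsto (fun r => r ^ 2 * q r) atTop (nhds L) := by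
    have hanti : Antitone (fun r => (max r a) ^ 2 * q (max r a)) := by
      intro x y hxy
      have : ∀ t, max t a ∈ Ioi (1:ℝ) := fun t =>
        lt_of_lt_of_le (by linarith) (le_max_right t a)
      exact h.strictAntiOn_flux.antitoneOn (this x) (this y) (max_le_max_right a hxy)
    refine ⟨_, (tendsto_atTop_ciInf hanti
      ⟨a ^ 2 * q a - 2, ?_⟩).congr' ?_⟩
    · rintro _ ⟨r, rfl⟩
      exact hlow _ (le_max_right _ _)
    · filter_upwards [eventually_ge_atTop a] with r hr
      rw [max_eq_left hr]
  obtain ⟨L, hL⟩ := hlim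
  refine ⟨-L, ?_, by simpa using hL⟩
  by_contra! hneg
  have hqpos : ∀ r, 1 < r → 0 < q r := by
    intro r hr
    have := h.strictAntiOn_flux.lt_of_tendsto_atTop hL hr
    have h1 : 0 < r ^ 2 * q r := by linarith
    exact pos_of_mul_pos_right h1 (by positivity)
  have hanti := strictAntiOn_Ioi_of_hasDerivAt_neg (fun r hr => (h.hasDerivAt r hr).neg)
    (fun r hr => by linarith [hqpos r hr])
  have h1 := hanti.lt_of_tendsto_atTop (r := 2) h.tendsto_zero.neg (by norm_num)
  have h2 := h.pos 2 (by norm_num)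
  rw [neg_zero, Pi.neg_apply] at h1
  linarith

theorem tendsto_mul_self (h : IsGroundProfile m Q q B) {l : ℝ}
    (hl : Tendsto (fun r => r ^ 2 * q r) atTop (nhds (-l))) :
    Tendsto (fun r => r * Q r) atTop (nhds l) := by
  have h1 : Tendsto (fun r => Q r / r⁻¹) atTop (nhds l) := by
    refine HasDerivAt.lhopital_zero_atTop (f' := q) (g' := fun r => -(r ^ 2)⁻¹) ?_ ?_ ?_
      h.tendsto_zero tendsto_inv_atTop_zero ?_
    · filter_upwards [eventually_gt_atTop 1] with r hr using h.hasDerivAt r hr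
    · filter_upwards [eventually_gt_atTop 1] with r hr using hasDerivAt_inv (by positivity)
    · filter_upwards [eventually_gt_atTop 1] with r hr
      have : 0 < r := by linarith
      have : 0 < (r ^ 2)⁻¹ := by positivity
      linarith
    · have := hl.neg
      rw [neg_neg] at this
      refine this.congr fun r => ?_
      rw [div_neg, div_inv_eq_mul]; ring
  refine h1.congr fun r => ?_
  rw [div_inv_eq_mul]; ring

/-- Logarithmic slope `-r Q'/Q`. -/
noncomputable def slope (Q q : ℝ → ℝ) (r : ℝ) : ℝ := -(r * q r) / Q r

/-- The scale-invariant ratio `r² Q^(2m)`. -/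
noncomputable def weight (m : ℕ) (Q : ℝ → ℝ) (r : ℝ) : ℝ := r ^ 2 * Q r ^ (2 * m)

/-- The scale-invariant ratio `B(r) / (r³ Q^(2m+2))`. -/
noncomputable def ratio (m : ℕ) (Q B : ℝ → ℝ) (r : ℝ) : ℝ := B r / (r ^ 3 * Q r ^ (2 * m + 2))

theorem tendsto_slope (h : IsGroundProfile m Q q B) :
    Tendsto (slope Q q) atTop (nhds 1) := by
  obtain ⟨l, hl0, hl⟩ := h.tendsto_flux
  have h1 := hl.neg.div (h.tendsto_mul_self hl) hl0.ne'
  rw [neg_neg, div_self hl0.ne'] at h1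
  refine h1.congr' ?_
  filter_upwards [eventually_gt_atTop 1] with r hr
  have := h.pos r hr
  have : 0 < r := by linarith
  simp only [slope, Pi.div_apply]
  field_simp

theorem tendsto_weight (h : IsGroundProfile m Q q B) :
    Tendsto (weight m Q) atTop (nhds 0) := by
  obtain ⟨l, hl0, hl⟩ := h.tendsto_flux
  obtain ⟨k, hk⟩ : ∃ k, m = k + 3 := ⟨m - 3, by have := h.two_lt; omega⟩
  have h1 := ((h.tendsto_mul_self hl).pow (2 * m)).mul
    (tendsto_inv_atTop_zero.pow (2 * k + 4))
  rw [zero_pow (by omega), mul_zero] at h1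
  refine h1.congr' ?_
  filter_upwards [eventually_gt_atTop 1] with r hr
  have : 0 < r := by linarith
  simp only [weight]
  rw [mul_pow, inv_pow, hk]
  field_simp
  ring

theorem tendsto_cube_mul (h : IsGroundProfile m Q q B) :
    Tendsto (fun r => r ^ 3 * Q r ^ (2 * m + 2)) atTop (nhds 0) := by
  have h1 := h.tendsto_weight.mul h.decay
  rw [mul_zero] at h1
  refine h1.congr fun r => ?_
  simp only [weight]; ring

/-- Pohozaev identity on `{t > r}`. -/
theorem pohozaev (h : IsGroundProfile m Q q B) {r : ℝ} (hr : 1 < r) :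
    ((m:ℝ) - 2) * B r = ((m:ℝ) + 1) * (r ^ 3 * q r ^ 2 + r ^ 2 * Q r * q r)
      + r ^ 3 * Q r ^ (2 * m + 2) := by
  set P : ℝ → ℝ := fun r => ((m:ℝ) + 1) * (r ^ 3 * q r ^ 2 + r ^ 2 * Q r * q r)
      + r ^ 3 * Q r ^ (2 * m + 2) - ((m:ℝ) - 2) * B r with hP
  have hd : ∀ x, 1 < x → HasDerivAt P 0 x := by
    intro x hx
    have hx0 : x ≠ 0 := by positivity
    have hQ := h.hasDerivAt x hx
    have hq := h.hasDerivAt_deriv x hx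
    have h1 := ((((hasDerivAt_pow 3 x).mul (hq.pow 2)).add
      (((hasDerivAt_pow 2 x).mul hQ).mul hq)).const_mul ((m:ℝ) + 1)).add
      ((hasDerivAt_pow 3 x).mul (hQ.pow (2 * m + 2)))
    have h2 := h1.sub ((h.hasDerivAt_tail x hx).const_mul ((m:ℝ) - 2))
    refine h2.congr_deriv ?_
    simp only [show 2 * m + 2 - 1 = 2 * m + 1 by omega, Pi.pow_apply, Pi.mul_apply]
    field_simp
    push_cast
    ring
  have hconst : ∀ x, r ≤ x → P x = P r := by
    intro x hx
    exact isOpen_Ioi.is_const_of_deriv_eq_zero isPreconnected_Ioi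
      (fun y hy => (hd y hy).differentiableAt.differentiableWithinAt)
      (fun y hy => (hd y hy).deriv) (show x ∈ Ioi 1 from hr.trans_le hx) hr
  have hlim : Tendsto P atTop (nhds 0) := by
    obtain ⟨l, hl0, hl⟩ := h.tendsto_flux
    have h1 : Tendsto (fun r => (r ^ 2 * q r) ^ 2 * r⁻¹) atTop (nhds 0) := by
      simpa using (hl.pow 2).mul tendsto_inv_atTop_zero
    have h2 : Tendsto (fun r => Q r * (r ^ 2 * q r)) atTop (nhds 0) := by
      simpa using h.tendsto_zero.mul hl
    have h3 := (((h1.add h2).const_mul ((m:ℝ) + 1)).add h.tendsto_cube_mul).sub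
      (h.tendsto_tail.const_mul ((m:ℝ) - 2))
    simp only [add_zero, mul_zero, sub_zero] at h3
    refine h3.congr' ?_
    filter_upwards [eventually_gt_atTop 1] with x hx
    have : 0 < x := by linarith
    simp only [hP]
    congr 3
    field_simp
  have h0 : P r = 0 := by
    refine tendsto_nhds_unique (tendsto_const_nhds.congr' ?_) hlim
    filter_upwards [eventually_ge_atTop r] with x hx using (hconst x hx).symm
  simp only [hP] at h0
  linarith

theorem weight_pos (h : IsGroundProfile m Q q B) {r : ℝ} (hr : 1 < r) : 0 < weight m Q r := by
  have := h.pos r hr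
  have : 0 < r := by linarith
  unfold weight
  positivity

theorem ratio_pos (h : IsGroundProfile m Q q B) {r : ℝ} (hr : 1 < r) : 0 < ratio m Q B r := by
  have := h.pos r hr
  have : 0 < r := by linarith
  have := h.tail_pos hr
  unfold ratio
  positivity

theorem weight_mul_ratio (h : IsGroundProfile m Q q B) {r : ℝ} (hr : 1 < r) :
    ((m:ℝ) - 2) * (weight m Q r * ratio m Q B r)
      = ((m:ℝ) + 1) * (slope Q q r ^ 2 - slope Q q r) + weight m Q r := by
  have := h.pos r hr
  have : 0 < r := by linarith
  have hp := h.pohozaev hr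
  have h1 : ((m:ℝ) - 2) * (weight m Q r * ratio m Q B r) = (((m:ℝ) - 2) * B r) / (r * Q r ^ 2) := by
    simp only [weight, ratio]
    field_simp
    ring
  rw [h1, hp]
  simp only [weight, slope]
  field_simp
  ring

theorem hasDerivAt_slope (h : IsGroundProfile m Q q B) {r : ℝ} (hr : 1 < r) :
    HasDerivAt (slope Q q) ((slope Q q r ^ 2 - slope Q q r + weight m Q r) / r) r := by
  have hQ0 := h.pos r hr
  have : 0 < r := by linarith
  have h1 := (((hasDerivAt_id r).mul (h.hasDerivAt_deriv r hr)).neg).div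
    (h.hasDerivAt r hr) hQ0.ne'
  refine h1.congr_deriv ?_
  simp only [slope, weight, Pi.mul_apply, id, Pi.neg_apply]
  field_simp
  ring

theorem slope_deriv_pos (h : IsGroundProfile m Q q B) {r : ℝ} (hr : 1 < r) :
    0 < slope Q q r ^ 2 - slope Q q r + weight m Q r := by
  have h1 := h.weight_mul_ratio hr
  have hw := h.weight_pos hr
  have h2 := mul_pos hw (h.ratio_pos hr)
  have hm : (2:ℝ) < m := by exact_mod_cast h.two_lt
  have h3 : 0 < ((m:ℝ) - 2) * (weight m Q r * ratio m Q B r) := mul_pos (by linarith) h2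
  have h4 : 0 < ((m:ℝ) + 1) * (slope Q q r ^ 2 - slope Q q r + weight m Q r) := by
    nlinarith
  exact pos_of_mul_pos_right h4 (by linarith)

theorem ratio_deriv_neg (h : IsGroundProfile m Q q B) {r : ℝ} (hr : 1 < r) :
    (-1 - 3 * ratio m Q B r + (2 * m + 2) * ratio m Q B r * slope Q q r) / r < 0 := by
  set F : ℝ → ℝ := fun r => r ^ 3 * Q r ^ (2 * m + 2)
    - ((2 * m + 2) * slope Q q r - 3) * B r with hF
  have hd : ∀ x, 1 < x → HasDerivAt F
      (-((2 * m + 2) * ((slope Q q x ^ 2 - slope Q q x + weight m Q x) / x) * B x)) x := by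
    intro x hx
    have hx0 : x ≠ 0 := by positivity
    have hQ0 := h.pos x hx
    have h1 := ((hasDerivAt_pow 3 x).mul ((h.hasDerivAt x hx).pow (2 * m + 2))).sub
      ((((h.hasDerivAt_slope hx).const_mul ((2:ℝ) * m + 2)).sub_const 3).mul
        (h.hasDerivAt_tail x hx))
    refine h1.congr_deriv ?_
    simp only [show 2 * m + 2 - 1 = 2 * m + 1 by omega, Pi.pow_apply]
    have e : q x = -(slope Q q x * Q x / x) := by
      simp only [slope]; field_simp
    rw [e]
    push_cast
    field_simp
    ring
  have hanti := strictAntiOn_Ioi_of_hasDerivAt_neg hd (fun x hx => by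
    have := h.slope_deriv_pos hx
    have := h.tail_pos hx
    have : 0 < x := by linarith
    have : 0 < (2 * (m:ℝ) + 2) * ((slope Q q x ^ 2 - slope Q q x + weight m Q x) / x) * B x := by
      positivity
    linarith)
  have hlim : Tendsto F atTop (nhds 0) := by
    have := h.tendsto_cube_mul.sub
      (((h.tendsto_slope.const_mul ((2:ℝ) * m + 2)).sub_const 3).mul h.tendsto_tail)
    simpa using this
  have h0 := hanti.lt_of_tendsto_atTop hlim hr
  have hQ0 := h.pos r hr
  have hr0 : 0 < r := by linarith
  have e : -1 - 3 * ratio m Q B r + (2 * m + 2) * ratio m Q B r * slope Q q r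
      = -(F r / (r ^ 3 * Q r ^ (2 * m + 2))) := by
    simp only [hF, ratio]
    field_simp
    ring
  rw [e]
  have : 0 < F r / (r ^ 3 * Q r ^ (2 * m + 2)) / r := by positivity
  rw [neg_div]; linarith

theorem hasDerivAt_ratio (h : IsGroundProfile m Q q B) {r : ℝ} (hr : 1 < r) :
    HasDerivAt (ratio m Q B)
      ((-1 - 3 * ratio m Q B r + (2 * m + 2) * ratio m Q B r * slope Q q r) / r) r := by
  have hQ0 := h.pos r hr
  have hr0 : 0 < r := by linarith
  have h1 := (h.hasDerivAt_tail r hr).div ((hasDerivAt_pow 3 r).mul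
    ((h.hasDerivAt r hr).pow (2 * m + 2))) (by simp only [Pi.mul_apply, Pi.pow_apply]; positivity)
  refine h1.congr_deriv ?_
  simp only [show 2 * m + 2 - 1 = 2 * m + 1 by omega, Pi.pow_apply, Pi.mul_apply, ratio, slope]
  push_cast
  field_simp
  ring

theorem hasDerivAt_weight (h : IsGroundProfile m Q q B) {r : ℝ} (hr : 1 < r) :
    HasDerivAt (weight m Q) (weight m Q r * (2 - 2 * m * slope Q q r) / r) r := by
  have hQ0 := h.pos r hr
  have hr0 : 0 < r := by linarith
  have h1 := (hasDerivAt_pow 2 r).mul ((h.hasDerivAt r hr).pow (2 * m))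
  refine h1.congr_deriv ?_
  obtain ⟨k, hk⟩ : ∃ k, m = k + 1 := ⟨m - 1, by have := h.two_lt; omega⟩
  subst hk
  simp only [show 2 * (k + 1) - 1 = 2 * k + 1 by omega, Pi.pow_apply, weight, slope]
  push_cast
  field_simp
  ring

theorem hasDerivAt_slope_add (h : IsGroundProfile m Q q B) {r : ℝ} (hr : 1 < r) :
    HasDerivAt (fun r => slope Q q r + weight m Q r * ratio m Q B r)
      (weight m Q r / (m + 1) *
      ((-1 - 3 * ratio m Q B r + (2 * m + 2) * ratio m Q B r * slope Q q r) / r)) r := by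
  have hr0 : 0 < r := by linarith
  have h1 := (h.hasDerivAt_slope hr).add ((h.hasDerivAt_weight hr).mul (h.hasDerivAt_ratio hr))
  refine h1.congr_deriv ?_
  have h2 := h.weight_mul_ratio hr
  generalize slope Q q r = z at *
  generalize weight m Q r = w at *
  generalize ratio m Q B r = x at *
  have : (0:ℝ) < m + 1 := by positivity
  field_simp
  linear_combination -h2

end IsGroundProfile

/-- Coefficients of a homogeneous calibration `r Y ψ(x)`, with `ψ(x) = ζ(x) + ω(x) x`. -/
structure IsCalibration (m : ℕ) (ζ ω : ℝ → ℝ) (L : ℝ) : Prop where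
  continuous : Continuous ζ
  nonneg : ∀ x, 0 ≤ ω x
  identity : ∀ x, ((m:ℝ) - 2) * (ω x * x) = ((m:ℝ) + 1) * (ζ x ^ 2 - ζ x) + ω x
  hasDerivAt : ∀ x, HasDerivAt (fun x => ζ x + ω x * x) (ω x / (m + 1)) x
  nonneg_value : ∀ x, 0 ≤ ζ x + ω x * x
  tendsto_div : Tendsto (fun x => (ζ x + ω x * x) ^ (m + 1) / x) atTop (nhds L)

theorem IsGroundProfile.tendsto_ratio_nhdsGT {m : ℕ} {Q q B : ℝ → ℝ}
    (h : IsGroundProfile m Q q B) {B₁ : ℝ} (hB₁ : 0 < B₁)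
    (hB : Tendsto B (nhdsWithin 1 (Ioi 1)) (nhds B₁))
    (hQ : Tendsto Q (nhdsWithin 1 (Ioi 1)) (nhds 0)) :
    Tendsto (ratio m Q B) (nhdsWithin 1 (Ioi 1)) atTop := by
  have hid : Tendsto (fun r : ℝ => r) (nhdsWithin 1 (Ioi 1)) (nhds 1) := nhdsWithin_le_nhds
  have h1 : Tendsto (fun r => r ^ 3 * Q r ^ (2 * m + 2)) (nhdsWithin 1 (Ioi 1))
      (nhdsWithin 0 (Ioi 0)) := by
    apply tendsto_nhdsWithin_of_tendsto_nhds_of_eventually_within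
    · have := (hid.pow 3).mul (hQ.pow (2 * m + 2))
      simpa using this
    · filter_upwards [self_mem_nhdsWithin] with r (hr : 1 < r)
      have := h.pos r hr
      have : 0 < r := by linarith
      exact mem_Ioi.mpr (by positivity)
  have h3 := hB.pos_mul_atTop hB₁ (tendsto_inv_nhdsGT_zero.comp h1)
  refine h3.congr fun r => ?_
  simp only [ratio, Function.comp_apply, div_eq_mul_inv]

theorem IsGroundProfile.slope_add_eq {m : ℕ} {Q q B : ℝ → ℝ}
    (h : IsGroundProfile m Q q B) {r : ℝ} (hr : 1 < r) :
    slope Q q r + weight m Q r * ratio m Q B r = (B r - r ^ 2 * Q r * q r) / (r * Q r ^ 2) := by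
  have := h.pos r hr
  have : 0 < r := by linarith
  simp only [slope, weight, ratio]
  field_simp
  ring

open IsGroundProfile in
theorem IsGroundProfile.exists_calibration {m : ℕ} {Q q B : ℝ → ℝ}
    (h : IsGroundProfile m Q q B) {A₁ B₁ : ℝ} (hB₁ : 0 < B₁)
    (hB : Tendsto B (nhdsWithin 1 (Ioi 1)) (nhds B₁))
    (hQ : Tendsto Q (nhdsWithin 1 (Ioi 1)) (nhds 0))
    (hA : Tendsto (fun r => B r - r ^ 2 * Q r * q r) (nhdsWithin 1 (Ioi 1)) (nhds A₁))
    (hApos : ∀ r, 1 < r → 0 ≤ B r - r ^ 2 * Q r * q r) :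
    ∃ (ζ ω T : ℝ → ℝ) (c : ℝ), IsCalibration m ζ ω (A₁ ^ (m + 1) / B₁) ∧ 0 ≤ c ∧
      (∀ x, c < x → 1 < T x ∧ ratio m Q B (T x) = x ∧ ζ x = slope Q q (T x)) ∧
      (∀ r, 1 < r → c < ratio m Q B r ∧ T (ratio m Q B r) = r) ∧
      (∀ x, c < x → HasDerivAt T (T x / (-1 - 3 * x + (2 * m + 2) * x * ζ x)) x ∧
        -1 - 3 * x + (2 * m + 2) * x * ζ x < 0) := by
  obtain ⟨c, T, hc0, hT, hTr, hTd, hTc, hTtop⟩ := exists_inverse_of_hasDerivAt_neg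
    (fun r hr => h.hasDerivAt_ratio hr) (fun r hr => h.ratio_deriv_neg hr)
    (fun r hr => h.ratio_pos hr) (h.tendsto_ratio_nhdsGT hB₁ hB hQ)
  have hm : (2:ℝ) < m := by exact_mod_cast h.two_lt
  set ζ : ℝ → ℝ := fun x => if c < x then slope Q q (T x) else 1 with hζ
  set ω : ℝ → ℝ := fun x => if c < x then weight m Q (T x) else 0 with hω
  have hζ1 : ∀ x, c < x → ζ x = slope Q q (T x) := fun x hx => by simp [hζ, hx]
  have hω1 : ∀ x, c < x → ω x = weight m Q (T x) := fun x hx => by simp [hω, hx]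
  have hζ0 : ∀ x, x ≤ c → ζ x = 1 := fun x hx => by simp [hζ, hx.not_gt]
  have hω0 : ∀ x, x ≤ c → ω x = 0 := fun x hx => by simp [hω, hx.not_gt]
  have hζlim : Tendsto ζ (nhdsWithin c (Ioi c)) (nhds 1) := by
    refine (h.tendsto_slope.comp hTc).congr' ?_
    filter_upwards [self_mem_nhdsWithin] with x hx using (hζ1 x hx).symm
  have hωlim : Tendsto ω (nhdsWithin c (Ioi c)) (nhds 0) := by
    refine (h.tendsto_weight.comp hTc).congr' ?_
    filter_upwards [self_mem_nhdsWithin] with x hx using (hω1 x hx).symm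
  have hid : ∀ x, ((m:ℝ) - 2) * (ω x * x) = ((m:ℝ) + 1) * (ζ x ^ 2 - ζ x) + ω x := by
    intro x
    rcases lt_or_ge c x with hx | hx
    · have := h.weight_mul_ratio (hT x hx).1
      rwa [(hT x hx).2, ← hζ1 x hx, ← hω1 x hx] at this
    · rw [hζ0 x hx, hω0 x hx]; ring
  have hdT : ∀ x, c < x → HasDerivAt T (T x / (-1 - 3 * x + (2 * m + 2) * x * ζ x)) x ∧
        -1 - 3 * x + (2 * m + 2) * x * ζ x < 0 := by
    intro x hx
    have h1 := hTd x hx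
    have h2 := h.ratio_deriv_neg (hT x hx).1
    rw [(hT x hx).2, ← hζ1 x hx] at h1 h2
    rw [inv_div] at h1
    refine ⟨h1, ?_⟩
    have : 0 < T x := by linarith [(hT x hx).1]
    rw [div_lt_iff₀ this] at h2
    linarith
  have hd1 : ∀ x, c < x → HasDerivAt (fun x => ζ x + ω x * x) (ω x / (m + 1)) x := by
    intro x hx
    have h1 := (h.hasDerivAt_slope_add (hT x hx).1).comp x (hdT x hx).1
    refine (h1.congr_of_eventuallyEq ?_).congr_deriv ?_
    · filter_upwards [Ioi_mem_nhds hx] with y hy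
      simp only [Function.comp_apply]
      rw [hζ1 y hy, hω1 y hy, (hT y hy).2]
    · rw [(hT x hx).2, ← hζ1 x hx, ← hω1 x hx]
      have : 0 < T x := by linarith [(hT x hx).1]
      have := (hdT x hx).2.ne
      generalize -1 - 3 * x + (2 * (m:ℝ) + 2) * x * ζ x = d at *
      field_simp
  have hψlim : Tendsto (fun x => ζ x + ω x * x) (nhdsWithin c (Ioi c)) (nhds 1) := by
    have h1 := hζlim.add (hωlim.mul (tendsto_nhdsWithin_of_tendsto_nhds tendsto_id (s := Ioi c)))
    simpa using h1
  have hψ0 : ∀ x, x ≤ c → ζ x + ω x * x = 1 := fun x hx => by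
    rw [hζ0 x hx, hω0 x hx]; ring
  have hdc : HasDerivAt (fun x => ζ x + ω x * x) (ω c / (m + 1)) c := by
    rw [hω0 c le_rfl, zero_div]
    have hr : HasDerivWithinAt (fun x => ζ x + ω x * x) 0 (Ici c) c := by
      apply hasDerivWithinAt_Ici_of_tendsto_deriv (s := Ioi c)
      · exact fun x hx => (hd1 x hx).differentiableAt.differentiableWithinAt
      · have h1 := hψlim
        rw [← hψ0 c le_rfl] at h1
        exact h1
      · exact self_mem_nhdsWithin
      · have h1 := hωlim.div_const ((m:ℝ) + 1)
        rw [zero_div] at h1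
        refine h1.congr' ?_
        filter_upwards [self_mem_nhdsWithin] with x hx using (hd1 x hx).deriv.symm
    have hl : HasDerivWithinAt (fun x => ζ x + ω x * x) 0 (Iic c) c :=
      (hasDerivWithinAt_const c (Iic c) (1:ℝ)).congr hψ0 (hψ0 c le_rfl)
    have := hl.union hr
    rwa [Iic_union_Ici, hasDerivWithinAt_univ] at this
  refine ⟨ζ, ω, T, c, ⟨?_, ?_, hid, ?_, ?_, ?_⟩, hc0,
    fun x hx => ⟨(hT x hx).1, (hT x hx).2, hζ1 x hx⟩, hTr, hdT⟩
  · rw [continuous_iff_continuousAt]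
    intro x
    rcases lt_trichotomy c x with hx | rfl | hx
    · have h1 := (h.hasDerivAt_slope (hT x hx).1).continuousAt.comp (hdT x hx).1.continuousAt
      refine h1.congr ?_
      filter_upwards [Ioi_mem_nhds hx] with y hy using (hζ1 y hy).symm
    · rw [continuousAt_iff_continuous_left'_right']
      refine ⟨?_, ?_⟩
      · refine (continuousWithinAt_const (b := (1:ℝ))).congr ?_ (hζ0 c le_rfl)
        exact fun y hy => hζ0 y (le_of_lt hy)
      · have h1 := hζlim
        rw [← hζ0 c le_rfl] at h1
        exact h1
    · refine (continuousAt_const (y := (1:ℝ))).congr ?_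
      filter_upwards [Iio_mem_nhds hx] with y hy using (hζ0 y (le_of_lt hy)).symm
  · intro x
    rcases lt_or_ge c x with hx | hx
    · rw [hω1 x hx]; exact (h.weight_pos (hT x hx).1).le
    · rw [hω0 x hx]
  · intro x
    rcases lt_trichotomy c x with hx | rfl | hx
    · exact hd1 x hx
    · exact hdc
    · rw [hω0 x hx.le, zero_div]
      refine (hasDerivAt_const x (1:ℝ)).congr_of_eventuallyEq ?_
      filter_upwards [Iio_mem_nhds hx] with y hy using hψ0 y (le_of_lt hy)
  · intro x
    rcases lt_or_ge c x with hx | hx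
    · have h1 := (hT x hx).1
      have h2 := h.slope_add_eq h1
      rw [(hT x hx).2, ← hζ1 x hx, ← hω1 x hx] at h2
      rw [h2]
      have := h.pos _ h1
      have := hApos _ h1
      have : 0 < T x := by linarith
      positivity
    · rw [hψ0 x hx]; exact zero_le_one
  · have hidr : Tendsto (fun r : ℝ => r) (nhdsWithin 1 (Ioi 1)) (nhds 1) := nhdsWithin_le_nhds
    obtain ⟨k, hk⟩ : ∃ k, m = k + 2 := ⟨m - 2, by have := h.two_lt; omega⟩
    have h1 : Tendsto (fun r => (B r - r ^ 2 * Q r * q r) ^ (m + 1) / (B r * r ^ k))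
        (nhdsWithin 1 (Ioi 1)) (nhds (A₁ ^ (m + 1) / (B₁ * 1 ^ k))) :=
      (hA.pow (m + 1)).div (hB.mul (hidr.pow k)) (by rw [one_pow, mul_one]; exact hB₁.ne')
    rw [one_pow, mul_one] at h1
    refine (h1.comp hTtop).congr' ?_
    filter_upwards [eventually_gt_atTop c] with x hx
    have hT1 := (hT x hx).1
    have h2 := h.slope_add_eq hT1
    have hxT := (hT x hx).2
    rw [hxT, ← hζ1 x hx, ← hω1 x hx] at h2
    rw [h2]
    have h3 := h.pos _ hT1
    have h4 := h.tail_pos hT1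
    have h5 : 0 < T x := by linarith
    simp only [Function.comp_apply]
    have hx' : x = B (T x) / (T x ^ 3 * Q (T x) ^ (2 * m + 2)) := hxT.symm
    rw [show (B (T x) - T x ^ 2 * Q (T x) * q (T x)) ^ (m + 1) / (B (T x) * T x ^ k)
      = ((B (T x) - T x ^ 2 * Q (T x) * q (T x)) / (T x * Q (T x) ^ 2)) ^ (m + 1) /
        (B (T x) / (T x ^ 3 * Q (T x) ^ (2 * m + 2))) by
      rw [div_pow, hk]; field_simp; ring, ← hx']

/-- The calibration `r Y ψ(b / (r³ Y^(m+1)))` with `Y = u² + e²`. -/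
noncomputable def calib (m : ℕ) (ζ ω u b : ℝ → ℝ) (e r : ℝ) : ℝ :=
  r * (u r ^ 2 + e ^ 2) * (ζ (b r / (r ^ 3 * (u r ^ 2 + e ^ 2) ^ (m + 1)))
    + ω (b r / (r ^ 3 * (u r ^ 2 + e ^ 2) ^ (m + 1)))
      * (b r / (r ^ 3 * (u r ^ 2 + e ^ 2) ^ (m + 1))))

/-- The defect in the calibration inequality. -/
noncomputable def defect (m : ℕ) (ζ u u' b : ℝ → ℝ) (e r : ℝ) : ℝ :=
  (r * u r * u' r + ζ (b r / (r ^ 3 * (u r ^ 2 + e ^ 2) ^ (m + 1))) * (u r ^ 2 + e ^ 2)) ^ 2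
    / (u r ^ 2 + e ^ 2)

theorem IsCalibration.exists_hasDerivAt_calib {m : ℕ} {ζ ω : ℝ → ℝ} {L : ℝ}
    (h : IsCalibration m ζ ω L) {u u' b : ℝ → ℝ} {e r : ℝ} (he : e ≠ 0) (hr : 1 < r)
    (hu : HasDerivAt u (u' r) r) (hb : HasDerivAt b (-((u r ^ 2) ^ (m + 1) * r ^ 2)) r) :
    ∃ W', HasDerivAt (calib m ζ ω u b e) W' r ∧
      -W' ≤ u' r ^ 2 * r ^ 2 - defect m ζ u u' b e r := by
  have hr0 : 0 < r := by linarith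
  have hY : HasDerivAt (fun r => u r ^ 2 + e ^ 2) (2 * u r * u' r) r := by
    refine ((hu.pow 2).add_const (e ^ 2)).congr_deriv ?_
    simp
  have hY0 : 0 < u r ^ 2 + e ^ 2 := by positivity
  have hx := hb.div ((hasDerivAt_pow 3 r).mul (hY.pow (m + 1)))
    (by simp only [Pi.mul_apply, Pi.pow_apply]; positivity)
  have hψ := (h.hasDerivAt (b r / (r ^ 3 * (u r ^ 2 + e ^ 2) ^ (m + 1)))).comp r hx
  have hW := ((hasDerivAt_id r).mul hY).mul hψ
  refine ⟨_, hW, ?_⟩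
  have hid := h.identity (b r / (r ^ 3 * (u r ^ 2 + e ^ 2) ^ (m + 1)))
  have hω := h.nonneg (b r / (r ^ 3 * (u r ^ 2 + e ^ 2) ^ (m + 1)))
  simp only [defect, Pi.mul_apply, Pi.pow_apply, Function.comp_apply, id, Nat.add_sub_cancel,
    Pi.div_apply]
  have hle : (u r ^ 2) ^ (m + 1) ≤ (u r ^ 2 + e ^ 2) ^ (m + 1) :=
    pow_le_pow_left₀ (sq_nonneg _) (by nlinarith [sq_nonneg e]) _
  have hsq : u r ^ 2 ≤ u r ^ 2 + e ^ 2 := by nlinarith [sq_nonneg e]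
  have hbx : b r = (b r / (r ^ 3 * (u r ^ 2 + e ^ 2) ^ (m + 1)))
      * (r ^ 3 * (u r ^ 2 + e ^ 2) ^ (m + 1)) := by field_simp
  set x := b r / (r ^ 3 * (u r ^ 2 + e ^ 2) ^ (m + 1)) with hxdef
  rw [hbx]
  generalize ζ x = z at *
  generalize ω x = w at *
  generalize (u r ^ 2) ^ (m + 1) = U at *
  clear_value x
  clear hbx hψ hW hx hY hb hxdef
  generalize u' r = v at *
  rw [pow_succ (u r ^ 2 + e ^ 2) m] at *
  generalize u r = a at *
  have hYm : 0 < (a ^ 2 + e ^ 2) ^ m := by positivity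
  generalize (a ^ 2 + e ^ 2) ^ m = P at *
  generalize a ^ 2 + e ^ 2 = Y at *
  have hm1 : (0:ℝ) < m + 1 := by positivity
  have h1 : (1 * Y + r * (2 * a * v)) * (z + w * x) + r * Y *
      (w / ((m:ℝ) + 1) * ((-(U * r ^ 2) * (r ^ 3 * (P * Y)) - x * (r ^ 3 * (P * Y)) *
        (((3:ℕ):ℝ) * r ^ (3 - 1) * (P * Y) + r ^ 3 * (((m + 1 : ℕ):ℝ) * P * (2 * a * v)))) /
          (r ^ 3 * (P * Y)) ^ 2))
      = Y * z ^ 2 + 2 * r * a * v * z + Y * w / (m + 1) * (1 - U / (P * Y)) := by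
    push_cast
    field_simp
    linear_combination (Y * P) * hid
  have h2 : 0 ≤ Y * w / (m + 1) * (1 - U / (P * Y)) := by
    have : U / (P * Y) ≤ 1 := (div_le_one (by positivity)).mpr hle
    have : 0 ≤ 1 - U / (P * Y) := by linarith
    positivity
  have h3 : (r * a * v + z * Y) ^ 2 / Y ≤ r ^ 2 * v ^ 2 + 2 * r * a * v * z + z ^ 2 * Y := by
    rw [div_le_iff₀ hY0]
    nlinarith [mul_nonneg (sub_nonneg.mpr hsq) (sq_nonneg (r * v))]
  rw [h1]
  linarith

theorem continuousOn_calib_arg {m : ℕ} {u b : ℝ → ℝ} {e : ℝ} (he : e ≠ 0)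
    (hu : ContinuousOn u (Ici 1)) (hb : ContinuousOn b (Ici 1)) :
    ContinuousOn (fun r => b r / (r ^ 3 * (u r ^ 2 + e ^ 2) ^ (m + 1))) (Ici 1) := by
  refine hb.div (by fun_prop) ?_
  intro r hr
  have : (0:ℝ) < r := lt_of_lt_of_le one_pos hr
  positivity

theorem IsCalibration.continuousOn_calib {m : ℕ} {ζ ω : ℝ → ℝ} {L : ℝ}
    (h : IsCalibration m ζ ω L) {u b : ℝ → ℝ} {e : ℝ} (he : e ≠ 0)
    (hu : ContinuousOn u (Ici 1)) (hb : ContinuousOn b (Ici 1)) :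
    ContinuousOn (calib m ζ ω u b e) (Ici 1) := by
  have hψ : Continuous (fun x => ζ x + ω x * x) :=
    continuous_iff_continuousAt.mpr fun x => (h.hasDerivAt x).continuousAt
  have h1 := hψ.comp_continuousOn (continuousOn_calib_arg (m := m) he hu hb)
  have h2 : ContinuousOn (fun r => r * (u r ^ 2 + e ^ 2)) (Ici 1) := by fun_prop
  exact h2.mul h1

theorem IsCalibration.aemeasurable_defect {m : ℕ} {ζ ω : ℝ → ℝ} {L : ℝ}
    (h : IsCalibration m ζ ω L) {u u' b : ℝ → ℝ} {e : ℝ}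
    (hu : ContinuousOn u (Ici 1)) (hu' : Measurable u') (hb : ContinuousOn b (Ici 1)) :
    AEMeasurable (defect m ζ u u' b e) (volume.restrict (Ici 1)) := by
  have hu1 : AEMeasurable u (volume.restrict (Ici 1)) := hu.aemeasurable measurableSet_Ici
  have hb1 : AEMeasurable b (volume.restrict (Ici 1)) := hb.aemeasurable measurableSet_Ici
  have hY : AEMeasurable (fun r => u r ^ 2 + e ^ 2) (volume.restrict (Ici 1)) := by fun_prop
  have hx := h.continuous.measurable.comp_aemeasurable
    (hb1.div ((measurable_id.pow_const 3).aemeasurable.mul (hY.pow_const (m + 1))))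
  exact (((((measurable_id.aemeasurable.mul hu1).mul hu'.aemeasurable)).add
    (hx.mul hY)).pow_const 2).div hY

theorem IsCalibration.integrableOn_defect {m : ℕ} {ζ ω : ℝ → ℝ} {L : ℝ}
    (h : IsCalibration m ζ ω L) {u u' b : ℝ → ℝ} {e R : ℝ} (he : e ≠ 0)
    (hu : ContinuousOn u (Ici 1)) (hu' : Measurable u') (hb : ContinuousOn b (Ici 1))
    (hint : IntegrableOn (fun r => u' r ^ 2 * r ^ 2) (Ioi 1)) :
    IntegrableOn (defect m ζ u u' b e) (Icc 1 R) := by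
  have hx := h.continuous.comp_continuousOn (continuousOn_calib_arg (m := m) he hu hb)
  have hc : ContinuousOn (fun r => 2 *
      (ζ (b r / (r ^ 3 * (u r ^ 2 + e ^ 2) ^ (m + 1))) ^ 2 * (u r ^ 2 + e ^ 2))) (Icc 1 R) :=
    ((continuousOn_const.mul ((hx.pow 2).mul (by fun_prop)))).mono Icc_subset_Ici_self
  have h1 : IntegrableOn (fun r => u' r ^ 2 * r ^ 2) (Icc 1 R) := by
    rw [integrableOn_Icc_iff_integrableOn_Ioc]
    exact hint.mono_set Ioc_subset_Ioi_self
  have h2 := (h1.const_mul 2).add hc.integrableOn_Icc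
  refine Integrable.mono' h2 ((h.aemeasurable_defect hu hu' hb).mono_measure
    (Measure.restrict_mono Icc_subset_Ici_self le_rfl)).aestronglyMeasurable ?_
  refine ae_of_all _ fun r => ?_
  have hY0 : 0 < u r ^ 2 + e ^ 2 := by positivity
  have hsq : u r ^ 2 ≤ u r ^ 2 + e ^ 2 := by nlinarith [sq_nonneg e]
  simp only [defect, Pi.add_apply]
  rw [Real.norm_of_nonneg (by positivity), div_le_iff₀ hY0]
  generalize ζ (b r / (r ^ 3 * (u r ^ 2 + e ^ 2) ^ (m + 1))) = z
  generalize u r ^ 2 + e ^ 2 = Y at *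
  nlinarith [mul_nonneg (sub_nonneg.mpr hsq) (sq_nonneg (r * u' r)),
    sq_nonneg (r * u r * u' r - z * Y)]

theorem IsCalibration.integral_defect_le {m : ℕ} {ζ ω : ℝ → ℝ} {L : ℝ}
    (h : IsCalibration m ζ ω L) {u u' b : ℝ → ℝ} {e R : ℝ} (he : e ≠ 0) (hR : 1 ≤ R)
    (hu : ContinuousOn u (Ici 1)) (hu' : Measurable u') (hb : ContinuousOn b (Ici 1))
    (hud : ∀ r, 1 < r → HasDerivAt u (u' r) r)
    (hbd : ∀ r, 1 < r → HasDerivAt b (-((u r ^ 2) ^ (m + 1) * r ^ 2)) r)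
    (hint : IntegrableOn (fun r => u' r ^ 2 * r ^ 2) (Ioi 1)) :
    ∫ r in Ioc 1 R, defect m ζ u u' b e r ≤
      (∫ r in Ioi 1, u' r ^ 2 * r ^ 2) + calib m ζ ω u b e R - calib m ζ ω u b e 1 := by
  have key : ∀ r, ∃ W', 1 < r → HasDerivAt (calib m ζ ω u b e) W' r ∧
      -W' ≤ u' r ^ 2 * r ^ 2 - defect m ζ u u' b e r := by
    intro r
    by_cases hr : 1 < r
    · obtain ⟨W', hW⟩ := h.exists_hasDerivAt_calib he hr (hud r hr) (hbd r hr)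
      exact ⟨W', fun _ => hW⟩
    · exact ⟨0, fun h => absurd h hr⟩
  choose W' hW' using key
  have h1 : IntegrableOn (fun r => u' r ^ 2 * r ^ 2) (Icc 1 R) := by
    rw [integrableOn_Icc_iff_integrableOn_Ioc]
    exact hint.mono_set Ioc_subset_Ioi_self
  have h2 := h.integrableOn_defect (R := R) he hu hu' hb hint
  have h3 := intervalIntegral.sub_le_integral_of_hasDeriv_right_of_le hR
    (g := fun r => -calib m ζ ω u b e r) (g' := fun r => -W' r)
    (φ := fun r => u' r ^ 2 * r ^ 2 - defect m ζ u u' b e r)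
    (((h.continuousOn_calib he hu hb).mono Icc_subset_Ici_self).neg)
    (fun r hr => (hW' r hr.1).1.neg.hasDerivWithinAt) (h1.sub h2)
    (fun r hr => (hW' r hr.1).2)
  rw [intervalIntegral.integral_of_le hR, integral_sub
    (h1.mono_set Ioc_subset_Icc_self) (h2.mono_set Ioc_subset_Icc_self)] at h3
  have h4 : ∫ t in Ioc 1 R, u' t ^ 2 * t ^ 2 ≤ ∫ t in Ioi 1, u' t ^ 2 * t ^ 2 := by
    apply setIntegral_mono_set hint
    · exact ae_of_all _ fun x => by positivity
    · exact Ioc_subset_Ioi_self.eventuallyLE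
  linarith

theorem IsCalibration.tendsto_calib_one {m : ℕ} {ζ ω : ℝ → ℝ} {L : ℝ}
    (h : IsCalibration m ζ ω L) {u : ℝ → ℝ} (hu1 : u 1 = 0) {b : ℕ → ℝ → ℝ} {e : ℕ → ℝ} {β : ℝ}
    (he0 : ∀ n, 0 < e n) (he : Tendsto e atTop (nhds 0)) (hβ : 0 < β)
    (hb : Tendsto (fun n => b n 1) atTop (nhds β)) :
    Tendsto (fun n => calib m ζ ω u (b n) (e n) 1) atTop
      (nhds ((β * L) ^ (((m + 1 : ℕ) : ℝ)⁻¹))) := by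
  have hpos : ∀ᶠ n in atTop, 0 < b n 1 := hb.eventually (eventually_gt_nhds hβ)
  have hE : Tendsto (fun n => ((e n ^ 2) ^ (m + 1))⁻¹) atTop atTop := by
    apply Tendsto.inv_tendsto_nhdsGT_zero
    refine tendsto_nhdsWithin_iff.mpr ⟨?_, Eventually.of_forall fun n => ?_⟩
    · simpa using (he.pow 2).pow (m + 1)
    · have := he0 n
      exact mem_Ioi.mpr (by positivity)
  have hx : Tendsto (fun n => b n 1 / (e n ^ 2) ^ (m + 1)) atTop atTop := by
    simpa only [div_eq_mul_inv] using hb.pos_mul_atTop hβ hE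
  have hW := hb.mul (h.tendsto_div.comp hx)
  have hmain : Tendsto (fun n => calib m ζ ω u (b n) (e n) 1 ^ (m + 1)) atTop
      (nhds (β * L)) := by
    refine hW.congr' ?_
    filter_upwards [hpos] with n hn
    have := he0 n
    simp only [calib, hu1, Function.comp_apply]
    have hsimp : b n 1 / (1 ^ 3 * ((0:ℝ) ^ 2 + e n ^ 2) ^ (m + 1))
        = b n 1 / (e n ^ 2) ^ (m + 1) := by ring_nf
    rw [hsimp, show (1:ℝ) * (0 ^ 2 + e n ^ 2) = e n ^ 2 by ring, mul_pow]
    field_simp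
  have hr := hmain.rpow_const (p := ((m + 1 : ℕ) : ℝ)⁻¹) (Or.inr (by positivity))
  refine hr.congr fun n => ?_
  refine Real.pow_rpow_inv_natCast ?_ (Nat.succ_ne_zero m)
  have := he0 n
  have h1 := h.nonneg_value (b n 1 / (1 ^ 3 * (u 1 ^ 2 + e n ^ 2) ^ (m + 1)))
  exact mul_nonneg (by positivity) h1

theorem IsCalibration.tendsto_defect {m : ℕ} {ζ ω : ℝ → ℝ} {L : ℝ}
    (h : IsCalibration m ζ ω L) {u u' b : ℝ → ℝ} {c : ℕ → ℝ} {e : ℕ → ℝ} {r : ℝ} (hr : 1 < r)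
    (he : Tendsto e atTop (nhds 0)) (hc : Tendsto c atTop (nhds 0)) (hu : u r ≠ 0) :
    Tendsto (fun n => defect m ζ u u' (fun r => b r - c n) (e n) r) atTop
      (nhds (defect m ζ u u' b 0 r)) := by
  have hY : Tendsto (fun n => u r ^ 2 + e n ^ 2) atTop (nhds (u r ^ 2 + 0 ^ 2)) :=
    (he.pow 2).const_add _
  have hb : Tendsto (fun n => b r - c n) atTop (nhds (b r)) := by
    simpa using hc.const_sub (b r)
  have hY0 : u r ^ 2 + 0 ^ 2 ≠ 0 := by positivity
  have hr0 : r ≠ 0 := by positivity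
  have hx := hb.div ((hY.pow (m + 1)).const_mul (r ^ 3)) (by positivity)
  have hz := (h.continuous.tendsto _).comp hx
  exact ((((hz.mul hY).const_add _).pow 2).div hY hY0)

theorem IsCalibration.ae_eq_of_le {m : ℕ} {ζ ω : ℝ → ℝ} {L : ℝ}
    (h : IsCalibration m ζ ω L) {u u' : ℝ → ℝ}
    (hu : ContinuousOn u (Ici 1)) (hu1 : u 1 = 0) (hu' : Measurable u')
    (hud : ∀ r, 1 < r → HasDerivAt u (u' r) r) (hulim : Tendsto u atTop (nhds 0))
    (hint : IntegrableOn (fun r => u' r ^ 2 * r ^ 2) (Ioi 1))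
    (hint' : IntegrableOn (fun r => (u r ^ 2) ^ (m + 1) * r ^ 2) (Ioi 1))
    (hB : 0 < ∫ r in Ioi 1, (u r ^ 2) ^ (m + 1) * r ^ 2)
    (hle : (∫ r in Ioi 1, u' r ^ 2 * r ^ 2) ^ (m + 1)
      ≤ (∫ r in Ioi 1, (u r ^ 2) ^ (m + 1) * r ^ 2) * L) :
    ∀ᵐ r ∂(volume.restrict (Ioi 1)), u r ≠ 0 →
      r * u' r + ζ ((∫ t in Ioi r, (u t ^ 2) ^ (m + 1) * t ^ 2)
        / (r ^ 3 * (u r ^ 2) ^ (m + 1))) * u r = 0 := by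
  set b : ℝ → ℝ := fun r => ∫ t in Ioi r, (u t ^ 2) ^ (m + 1) * t ^ 2 with hbdef
  set A := ∫ r in Ioi 1, u' r ^ 2 * r ^ 2 with hA
  have hA0 : 0 ≤ A := by
    apply integral_nonneg
    intro r
    positivity
  have hb : ContinuousOn b (Ici 1) := continuousOn_integral_Ioi hint'
  have hbd : ∀ r, 1 < r → HasDerivAt b (-((u r ^ 2) ^ (m + 1) * r ^ 2)) r := fun r hr =>
    hasDerivAt_integral_Ioi hint' (((hu.mono Ioi_subset_Ici_self).pow 2 |>.pow (m + 1)).mul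
      (by fun_prop)) hr
  have hblim : Tendsto b atTop (nhds 0) := tendsto_integral_Ioi_zero hint'
  let e : ℕ → ℝ := fun n => 1 / ((n:ℝ) + 1)
  let R : ℕ → ℝ := fun n => (n:ℝ) + 2
  have he0 : ∀ n, 0 < e n := fun n => by positivity
  have he : Tendsto e atTop (nhds 0) := tendsto_one_div_add_atTop_nhds_zero_nat
  have hR : Tendsto R atTop atTop := tendsto_atTop_add_const_right _ _ tendsto_natCast_atTop_atTop
  have hR1 : ∀ n, 1 ≤ R n := fun n => by
    have : (0:ℝ) ≤ n := n.cast_nonneg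
    simp only [R]
    linarith
  have hc : Tendsto (fun n => b (R n)) atTop (nhds 0) := hblim.comp hR
  have hK := h.tendsto_calib_one (u := u) hu1 (b := fun n r => b r - b (R n)) (β := b 1) he0 he hB
    (by simpa using hc.const_sub (b 1))
  have hend : Tendsto (fun n => calib m ζ ω u (fun r => b r - b (R n)) (e n) (R n)) atTop
      (nhds 0) := by
    have h1 : Tendsto (fun n => R n * u (R n) ^ 2) atTop (nhds 0) :=
      (tendsto_mul_sq_atTop hud hulim hint).comp hR
    have h2 : Tendsto (fun n => R n * e n ^ 2) atTop (nhds 0) := by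
      have : Tendsto (fun n => e n + e n ^ 2) atTop (nhds 0) := by simpa using he.add (he.pow 2)
      refine this.congr fun n => ?_
      simp only [R, e]
      field_simp
      ring
    have h3 : Tendsto (fun n => (R n * u (R n) ^ 2 + R n * e n ^ 2) * ζ 0) atTop (nhds 0) := by
      simpa using (h1.add h2).mul_const (ζ 0)
    refine h3.congr fun n => ?_
    simp only [calib, sub_self, zero_div, mul_zero, add_zero]
    ring
  have hKA : A ≤ (b 1 * L) ^ (((m + 1 : ℕ) : ℝ)⁻¹) := by
    rw [← Real.pow_rpow_inv_natCast hA0 (Nat.succ_ne_zero m)]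
    exact Real.rpow_le_rpow (by positivity) hle (by positivity)
  have hε : Tendsto (fun n => ENNReal.ofReal (A
      + calib m ζ ω u (fun r => b r - b (R n)) (e n) (R n)
      - calib m ζ ω u (fun r => b r - b (R n)) (e n) 1)) atTop (nhds 0) := by
    have := ENNReal.tendsto_ofReal ((hend.const_add A).sub hK)
    rwa [ENNReal.ofReal_of_nonpos (by linarith)] at this
  let f : ℕ → ℝ → ENNReal := fun n => (Ioc 1 (R n)).indicator
    fun r => ENNReal.ofReal (defect m ζ u u' (fun r => b r - b (R n)) (e n) r)
  have hbn : ∀ n, ContinuousOn (fun r => b r - b (R n)) (Ici 1) := fun n =>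
    hb.sub continuousOn_const
  have hrestr : ∀ {F : ℝ → ℝ}, AEMeasurable F (volume.restrict (Ici 1)) →
      AEMeasurable F (volume.restrict (Ioi 1)) := fun hF =>
    hF.mono_measure (Measure.restrict_mono Ioi_subset_Ici_self le_rfl)
  have hfm : ∀ n, AEMeasurable (f n) (volume.restrict (Ioi 1)) := fun n =>
    (hrestr (h.aemeasurable_defect hu hu' (hbn n))).ennreal_ofReal.indicator measurableSet_Ioc
  have hdef0 : ∀ (b' : ℝ → ℝ) e' r, 0 ≤ defect m ζ u u' b' e' r := fun b' e' r => by
    unfold defect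
    positivity
  have hfle : ∀ n, ∫⁻ r in Ioi 1, f n r ≤ ENNReal.ofReal (A
      + calib m ζ ω u (fun r => b r - b (R n)) (e n) (R n)
      - calib m ζ ω u (fun r => b r - b (R n)) (e n) 1) := by
    intro n
    rw [lintegral_indicator measurableSet_Ioc, Measure.restrict_restrict measurableSet_Ioc,
      inter_eq_left.mpr Ioc_subset_Ioi_self]
    rw [← ofReal_integral_eq_lintegral_ofReal]
    · refine ENNReal.ofReal_le_ofReal (h.integral_defect_le (he0 n).ne' (hR1 n) hu hu' (hbn n)
        hud ?_ hint)
      intro r hr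
      exact (hbd r hr).sub_const _
    · exact (h.integrableOn_defect (he0 n).ne' hu hu' (hbn n) hint).mono_set Ioc_subset_Icc_self
    · exact ae_of_all _ fun r => hdef0 _ _ r
  have hg : ∫⁻ r in Ioi 1, ENNReal.ofReal (defect m ζ u u' b 0 r) = 0 := by
    refine le_antisymm ?_ zero_le
    calc ∫⁻ r in Ioi 1, ENNReal.ofReal (defect m ζ u u' b 0 r)
        ≤ ∫⁻ r in Ioi 1, liminf (fun n => f n r) atTop := by
          refine setLIntegral_mono' measurableSet_Ioi fun r hr => ?_
          by_cases hur : u r = 0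
          · simp [defect, hur]
          · have h1 := ENNReal.tendsto_ofReal
              (h.tendsto_defect (u' := u') (b := b) (mem_Ioi.mp hr) he hc hur)
            refine le_of_eq (Tendsto.liminf_eq (h1.congr' ?_)).symm
            filter_upwards [hR.eventually_ge_atTop r] with n hn
            have hmem : r ∈ Ioc 1 (R n) := ⟨hr, hn⟩
            simp only [f, indicator_of_mem hmem]
      _ ≤ liminf (fun n => ∫⁻ r in Ioi 1, f n r) atTop := lintegral_liminf_le' hfm
      _ ≤ liminf (fun n => ENNReal.ofReal (A
          + calib m ζ ω u (fun r => b r - b (R n)) (e n) (R n)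
          - calib m ζ ω u (fun r => b r - b (R n)) (e n) 1)) atTop :=
          liminf_le_liminf (Eventually.of_forall hfle)
      _ = 0 := hε.liminf_eq
  rw [lintegral_eq_zero_iff' (hrestr (h.aemeasurable_defect hu hu' hb)).ennreal_ofReal] at hg
  filter_upwards [hg] with r hr hur
  have h0 : defect m ζ u u' b 0 r = 0 :=
    le_antisymm (ENNReal.ofReal_eq_zero.mp hr) (hdef0 _ _ r)
  simp only [defect] at h0
  have hne : u r ^ 2 + (0:ℝ) ^ 2 ≠ 0 := by positivity
  rw [div_eq_zero_iff, or_iff_left hne, sq_eq_zero_iff] at h0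
  simp only [ne_eq, OfNat.ofNat_ne_zero, not_false_eq_true, zero_pow, add_zero] at h0
  refine mul_left_cancel₀ hur ?_
  linear_combination h0

theorem eq_of_ae_eq_of_hasDerivAt {u u' g : ℝ → ℝ} {s : Set ℝ} (hs : IsOpen s)
    (hud : ∀ r ∈ s, HasDerivAt u (u' r) r) (hg : ContinuousOn g s)
    (hae : ∀ᵐ r, r ∈ s → u' r = g r) {r : ℝ} (hr : r ∈ s) : u' r = g r := by
  obtain ⟨ε, hε, hball⟩ := Metric.isOpen_iff.mp hs r hr
  have hG : HasDerivAt (fun y => u r + ∫ t in r..y, g t) (g r) r :=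
    (intervalIntegral.integral_hasDerivAt_right IntervalIntegrable.refl
      (hg.stronglyMeasurableAtFilter hs r hr) (hg.continuousAt (hs.mem_nhds hr))).const_add _
  refine (hud r hr).unique (hG.congr_of_eventuallyEq ?_)
  filter_upwards [Metric.ball_mem_nhds r hε] with y hy
  have hsub : uIcc r y ⊆ s := by
    refine (OrdConnected.uIcc_subset ?_ (Metric.mem_ball_self hε) hy).trans hball
    exact (convex_ball r ε).ordConnected
  have hgi : IntervalIntegrable g volume r y := (hg.mono hsub).intervalIntegrable
  have hcongr : ∀ᵐ t, t ∈ uIoc r y → g t = u' t := by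
    filter_upwards [hae] with t ht htm
    exact (ht (hsub (uIoc_subset_uIcc htm))).symm
  have hui : IntervalIntegrable u' volume r y :=
    hgi.congr_ae ((ae_restrict_iff' measurableSet_uIoc).mpr hcongr)
  have h1 := intervalIntegral.integral_eq_sub_of_hasDerivAt
    (fun t ht => hud t (hsub ht)) hui
  have h2 := intervalIntegral.integral_congr_ae hcongr
  rw [h2, h1]
  ring

theorem eventually_eq_of_hasDerivAt_zero {F : ℝ → ℝ} {r : ℝ}
    (h : ∀ᶠ s in nhds r, HasDerivAt F 0 s) : ∀ᶠ s in nhds r, F s = F r := by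
  obtain ⟨ε, hε, hball⟩ := Metric.eventually_nhds_iff_ball.mp h
  filter_upwards [Metric.ball_mem_nhds r hε] with s hs
  have := (convex_ball r ε).norm_image_sub_le_of_norm_hasDerivWithin_le (C := 0)
    (fun x hx => (hball x hx).hasDerivWithinAt) (fun _ _ => by simp)
    (Metric.mem_ball_self hε) hs
  rw [zero_mul, norm_le_zero_iff, sub_eq_zero] at this
  exact this

/-- The scale-invariant ratio `b / (r³ (u²)^(m+1))`, which is `IsGroundProfile.ratio` when
`u > 0`. -/
noncomputable def sqRatio (m : ℕ) (u b : ℝ → ℝ) (r : ℝ) : ℝ := b r / (r ^ 3 * (u r ^ 2) ^ (m + 1))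

theorem IsGroundProfile.exists_rescale {m : ℕ} {Q q B : ℝ → ℝ} (h : IsGroundProfile m Q q B)
    {ζ T : ℝ → ℝ} {c : ℝ} (hζ : Continuous ζ)
    (hT : ∀ x, c < x → 1 < T x ∧ ratio m Q B (T x) = x ∧ ζ x = slope Q q (T x))
    (hTr : ∀ r, 1 < r → c < ratio m Q B r ∧ T (ratio m Q B r) = r)
    (hTd : ∀ x, c < x → HasDerivAt T (T x / (-1 - 3 * x + (2 * m + 2) * x * ζ x)) x ∧
      -1 - 3 * x + (2 * m + 2) * x * ζ x < 0)
    {u u' b : ℝ → ℝ} (hu : ContinuousOn u (Ici 1)) (hu1 : u 1 = 0)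
    (hud : ∀ r, 1 < r → HasDerivAt u (u' r) r)
    (hbd : ∀ r, 1 < r → HasDerivAt b (-((u r ^ 2) ^ (m + 1) * r ^ 2)) r)
    (hae : ∀ᵐ r ∂(volume.restrict (Ioi 1)), u r ≠ 0 →
      r * u' r + ζ (sqRatio m u b r) * u r = 0)
    {r₀ : ℝ} (hr₀ : 1 < r₀) (hur₀ : u r₀ ≠ 0) (hc : c < sqRatio m u b r₀) :
    ∃ α k, 1 ≤ α ∧ α < r₀ ∧ k ≠ 0 ∧ ∀ r, α < r → u r = k * Q (r / α) := by
  set η := sqRatio m u b with hη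
  have hηc : ∀ r, 1 < r → u r ≠ 0 → ContinuousAt η r := by
    intro r hr hur
    have h1 := (hbd r hr).continuousAt
    have h2 := (hud r hr).continuousAt
    refine h1.div ((continuousAt_id.pow 3).mul ((h2.pow 2).pow (m + 1))) ?_
    have : r ≠ 0 := by positivity
    positivity
  let S : Set ℝ := {r | 1 < r ∧ u r ≠ 0 ∧ c < η r}
  have hS : IsOpen S := by
    refine isOpen_iff_mem_nhds.mpr fun r hr => ?_
    filter_upwards [lt_mem_nhds hr.1, (hud r hr.1).continuousAt.eventually_ne hr.2.1,
      (hηc r hr.1 hr.2.1).eventually (lt_mem_nhds hr.2.2)] with s h1 h2 h3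
    exact ⟨h1, h2, h3⟩
  have hu'S : ∀ r ∈ S, u' r = -(ζ (η r) * u r) / r := by
    intro r hr
    refine eq_of_ae_eq_of_hasDerivAt (g := fun r => -(ζ (η r) * u r) / r) hS
      (fun r hr => hud r hr.1) ?_ ?_ hr
    · intro s hs
      have h1 := (hud s hs.1).continuousAt
      have h2 := hζ.continuousAt.comp (hηc s hs.1 hs.2.1)
      have hs1 : s ≠ 0 := by linarith [hs.1]
      exact ((h2.mul h1).neg.div continuousAt_id hs1).continuousWithinAt
    · rw [ae_restrict_iff' measurableSet_Ioi] at hae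
      filter_upwards [hae] with s hs hsS
      have := hs hsS.1 hsS.2.1
      have hs0 : s ≠ 0 := by linarith [hsS.1]
      field_simp
      linarith
  have hηd : ∀ r ∈ S, HasDerivAt η ((-1 - 3 * η r + (2 * m + 2) * η r * ζ (η r)) / r) r := by
    intro r hr
    have hr0 : r ≠ 0 := by linarith [hr.1]
    have hur := hr.2.1
    have h1 := hud r hr.1
    rw [hu'S r hr] at h1
    have h2 := (hbd r hr.1).div ((hasDerivAt_pow 3 r).mul ((h1.pow 2).pow (m + 1)))
      (by simp only [Pi.mul_apply, Pi.pow_apply]; positivity)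
    refine h2.congr_deriv ?_
    simp only [Pi.mul_apply, Pi.pow_apply, Nat.add_sub_cancel]
    have hb : b r = η r * (r ^ 3 * (u r ^ 2) ^ (m + 1)) := by
      simp only [hη, sqRatio]
      field_simp
    rw [hb]
    generalize ζ (η r) = z
    generalize η r = x
    generalize u r = a at *
    push_cast
    have hP : (a ^ 2) ^ m ≠ 0 := by positivity
    rw [pow_succ (a ^ 2) m]
    generalize (a ^ 2) ^ m = P at *
    field_simp
    ring
  have hTη : ∀ r ∈ S, HasDerivAt (fun r => T (η r)) (T (η r) / r) r := by
    intro r hr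
    obtain ⟨h1, h2⟩ := hTd (η r) hr.2.2
    refine (h1.comp r (hηd r hr)).congr_deriv ?_
    have hr0 : r ≠ 0 := by linarith [hr.1]
    generalize -1 - 3 * η r + (2 * (m:ℝ) + 2) * η r * ζ (η r) = D at *
    have := h2.ne
    field_simp
  have hF : ∀ r ∈ S, HasDerivAt (fun r => T (η r) / r) 0 r := by
    intro r hr
    have hr0 : r ≠ 0 := by linarith [hr.1]
    refine ((hTη r hr).div (hasDerivAt_id r) hr0).congr_deriv ?_
    simp only [id]
    field_simp
    ring
  have hG : ∀ r ∈ S, HasDerivAt (fun r => u r / Q (T (η r))) 0 r := by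
    intro r hr
    have hr0 : r ≠ 0 := by linarith [hr.1]
    obtain ⟨h1, -, h3⟩ := hT (η r) hr.2.2
    have hQ := (h.pos _ h1).ne'
    have h4 := hud r hr.1
    rw [hu'S r hr, h3] at h4
    refine (h4.div ((h.hasDerivAt _ h1).comp r (hTη r hr)) hQ).congr_deriv ?_
    simp only [Function.comp_apply, slope]
    field_simp
    ring
  obtain ⟨hT1, hT2, -⟩ := hT (η r₀) hc
  have hr₀0 : 0 < r₀ := by linarith
  set l := T (η r₀) / r₀ with hl
  have hl0 : 0 < l := by positivity
  have hlr₀ : l * r₀ = T (η r₀) := by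
    rw [hl]
    field_simp
  set k := u r₀ / Q (T (η r₀)) with hk
  have hQ₀ := h.pos _ hT1
  have hk0 : k ≠ 0 := div_ne_zero hur₀ hQ₀.ne'
  let I : Set ℝ := Ioi (max 1 (1 / l))
  have hI : ∀ r ∈ I, 1 < r ∧ 1 < l * r := by
    intro r hr
    have hr : max 1 (1 / l) < r := hr
    refine ⟨lt_of_le_of_lt (le_max_left _ _) hr, ?_⟩
    have := lt_of_le_of_lt (le_max_right _ _) hr
    rwa [div_lt_iff₀' hl0] at this
  have hIof : ∀ r, 1 < r → 1 < l * r → r ∈ I := fun r h1 h2 =>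
    max_lt h1 (by rwa [div_lt_iff₀' hl0])
  let K := (k ^ 2) ^ (m + 1) / l ^ 3
  let G : Set ℝ := {r | r ∈ I ∧ u r - k * Q (l * r) = 0 ∧ b r - K * B (l * r) = 0}
  have hratio : ∀ r ∈ I, u r = k * Q (l * r) →
      (b r - K * B (l * r) = 0 ↔ η r = ratio m Q B (l * r)) := by
    intro r hr hur
    obtain ⟨h1, h2⟩ := hI r hr
    have hQ := (h.pos _ h2).ne'
    have hr0 : r ≠ 0 := by positivity
    simp only [hη, sqRatio, ratio, hur, K]
    rw [div_eq_div_iff (by positivity) (by positivity), sub_eq_zero,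
      show (k * Q (l * r)) ^ 2 = k ^ 2 * Q (l * r) ^ 2 by ring, mul_pow (k ^ 2),
      ← pow_mul (Q (l * r)), show 2 * (m + 1) = 2 * m + 2 by ring]
    have hP : Q (l * r) ^ (2 * m + 2) ≠ 0 := by positivity
    generalize Q (l * r) ^ (2 * m + 2) = P at *
    rw [div_mul_eq_mul_div, eq_div_iff (by positivity)]
    constructor
    · intro h
      linear_combination (r ^ 3 * P) * h
    · intro h
      refine mul_left_cancel₀ (mul_ne_zero (pow_ne_zero 3 hr0) hP) ?_
      linear_combination h
  have hGS : ∀ r ∈ G, r ∈ S ∧ T (η r) = l * r := by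
    rintro r ⟨hr, h1, h2⟩
    have h1 := sub_eq_zero.mp h1
    rw [hratio r hr h1] at h2
    obtain ⟨h3, h4⟩ := hI r hr
    obtain ⟨h5, h6⟩ := hTr _ h4
    refine ⟨⟨h3, ?_, by rwa [h2]⟩, by rw [h2, h6]⟩
    rw [h1]
    exact mul_ne_zero hk0 (h.pos _ h4).ne'
  have hGopen : IsOpen G := by
    refine isOpen_iff_mem_nhds.mpr fun r hr => ?_
    obtain ⟨hrS, hrT⟩ := hGS r hr
    have hr0 : 0 < r := by linarith [hrS.1]
    filter_upwards [hS.mem_nhds hrS, isOpen_Ioi.mem_nhds hr.1,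
      eventually_eq_of_hasDerivAt_zero
        (Filter.mem_of_superset (hS.mem_nhds hrS) fun s hs => hF s hs),
      eventually_eq_of_hasDerivAt_zero
        (Filter.mem_of_superset (hS.mem_nhds hrS) fun s hs => hG s hs)] with s hs hsI h1 h2
    have hs0 : 0 < s := by linarith [hs.1]
    have hTs : T (η s) = l * s := by
      rw [hrT, mul_div_cancel_right₀ _ hr0.ne'] at h1
      rwa [div_eq_iff hs0.ne'] at h1
    have hQr := (h.pos _ (hI r hr.1).2).ne'
    have hQs := (h.pos _ (hI s hsI).2).ne'
    have hus : u s = k * Q (l * s) := by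
      rw [hrT, hTs, sub_eq_zero.mp hr.2.1, mul_div_cancel_right₀ _ hQr] at h2
      rwa [div_eq_iff hQs] at h2
    refine ⟨hsI, sub_eq_zero.mpr hus, (hratio s hsI hus).mpr ?_⟩
    rw [← hTs, (hT _ hs.2.2).2.1]
  have hr₀I : r₀ ∈ I := hIof r₀ hr₀ (by rwa [hlr₀])
  have hr₀G : r₀ ∈ G := by
    have hu₀ : u r₀ = k * Q (l * r₀) := by
      rw [hlr₀, hk]
      field_simp
    refine ⟨hr₀I, sub_eq_zero.mpr hu₀, (hratio r₀ hr₀I hu₀).mpr ?_⟩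
    rw [hlr₀, hT2]
  have hclosed : closure G ∩ I ⊆ G := by
    rintro r ⟨hr, hrI⟩
    obtain ⟨h1, h2⟩ := hI r hrI
    have hmul : ContinuousAt (fun r => l * r) r := by fun_prop
    have hv : ContinuousAt (fun r => u r - k * Q (l * r)) r :=
      (hud r h1).continuousAt.sub (continuousAt_const.mul
        (ContinuousAt.comp (h.hasDerivAt _ h2).continuousAt hmul))
    have hw : ContinuousAt (fun r => b r - K * B (l * r)) r :=
      (hbd r h1).continuousAt.sub (continuousAt_const.mul
        (ContinuousAt.comp (h.hasDerivAt_tail _ h2).continuousAt hmul))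
    have := mem_closure_iff_nhdsWithin_neBot.mp hr
    refine ⟨hrI, ?_, ?_⟩
    · refine tendsto_nhds_unique (l := nhdsWithin r G) (hv.mono_left nhdsWithin_le_nhds)
        (tendsto_const_nhds.congr' ?_)
      filter_upwards [self_mem_nhdsWithin] with s hs
      exact hs.2.1.symm
    · refine tendsto_nhds_unique (l := nhdsWithin r G) (hw.mono_left nhdsWithin_le_nhds)
        (tendsto_const_nhds.congr' ?_)
      filter_upwards [self_mem_nhdsWithin] with s hs
      exact hs.2.2.symm
  have hIG : I ⊆ G := isPreconnected_Ioi.subset_of_closure_inter_subset hGopen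
    ⟨r₀, hr₀I, hr₀G⟩ hclosed
  have huI : ∀ r ∈ I, u r = k * Q (l * r) := fun r hr => sub_eq_zero.mp (hIG hr).2.1
  have hl1 : l ≤ 1 := by
    by_contra! hl1
    have hlim : Tendsto u (nhdsWithin 1 (Ioi 1)) (nhds 0) := by
      have := (hu 1 self_mem_Ici).mono Ioi_subset_Ici_self
      rwa [ContinuousWithinAt, hu1] at this
    have hlim' : Tendsto (fun r => k * Q (l * r)) (nhdsWithin 1 (Ioi 1)) (nhds (k * Q (l * 1))) := by
      have hmul : ContinuousAt (fun r : ℝ => l * r) 1 := by fun_prop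
      have h2 : 1 < l * 1 := by linarith
      have hv : ContinuousAt (fun r => k * Q (l * r)) 1 := continuousAt_const.mul
        (ContinuousAt.comp (h.hasDerivAt _ h2).continuousAt hmul)
      exact hv.mono_left nhdsWithin_le_nhds
    have := tendsto_nhds_unique (hlim.congr' ?_) hlim'
    · exact mul_ne_zero hk0 (h.pos _ (by linarith)).ne' this.symm
    · filter_upwards [self_mem_nhdsWithin] with s hs
      have hs : 1 < s := hs
      exact huI s (hIof s hs (by nlinarith))
  have h1l : 1 ≤ 1 / l := by rwa [one_le_div hl0]
  refine ⟨1 / l, k, h1l, ?_, hk0, fun r hr => ?_⟩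
  · rw [div_lt_iff₀' hl0, hlr₀]
    exact hT1
  · rw [huI r (max_lt (lt_of_le_of_lt h1l hr) hr)]
    congr 2
    field_simp

theorem exists_lt_sqRatio {m : ℕ} {u b : ℝ → ℝ} (hu : ContinuousOn u (Ici 1)) (hu1 : u 1 = 0)
    {r₁ : ℝ} (hr₁ : 1 < r₁) (hur₁ : u r₁ ≠ 0) (hb₁ : 0 < b r₁)
    (hb : ∀ r, 1 ≤ r → r ≤ r₁ → b r₁ ≤ b r) (c : ℝ) :
    ∃ r₀, 1 < r₀ ∧ r₀ ≤ r₁ ∧ u r₀ ≠ 0 ∧ c < sqRatio m u b r₀ := by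
  have hZ : IsCompact (Icc 1 r₁ ∩ u ⁻¹' {0}) :=
    isCompact_Icc.of_isClosed_subset ((hu.mono Icc_subset_Ici_self).preimage_isClosed_of_isClosed
      isClosed_Icc isClosed_singleton) inter_subset_left
  obtain ⟨γ, ⟨hγ, hγ0⟩, hmax⟩ := hZ.exists_isGreatest ⟨1, ⟨le_rfl, hr₁.le⟩, hu1⟩
  have hγ0 : u γ = 0 := hγ0
  have hγr : γ < r₁ := lt_of_le_of_ne hγ.2 fun h => hur₁ (h ▸ hγ0)
  have hlim : Tendsto (fun r => c * (r ^ 3 * (u r ^ 2) ^ (m + 1))) (nhdsWithin γ (Ioi γ))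
      (nhds 0) := by
    have hc : ContinuousOn (fun r => c * (r ^ 3 * (u r ^ 2) ^ (m + 1))) (Ici 1) := by fun_prop
    have := (hc γ hγ.1).mono (Ioi_subset_Ici hγ.1)
    rw [ContinuousWithinAt, hγ0] at this
    simpa using this
  obtain ⟨r, hr, hrm⟩ := ((hlim.eventually (gt_mem_nhds hb₁)).and
    (Ioo_mem_nhdsGT hγr)).exists
  have hr1 : 1 < r := lt_of_le_of_lt hγ.1 hrm.1
  have hur : u r ≠ 0 := fun h0 => absurd (hmax ⟨⟨hr1.le, hrm.2.le⟩, h0⟩) (not_le.mpr hrm.1)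
  have hr0 : 0 < r := by linarith
  refine ⟨r, hr1, hrm.2.le, hur, ?_⟩
  rw [sqRatio, lt_div_iff₀ (by positivity)]
  exact hr.trans_le (hb r hr1.le hrm.2.le)

theorem exists_eq_rescale_of_local {m : ℕ} {Q u b : ℝ → ℝ} {c : ℝ}
    (hQpos : ∀ r, 1 < r → 0 < Q r) (hQ : Tendsto Q (nhdsWithin 1 (Ioi 1)) (nhds 0))
    (hu : ContinuousOn u (Ici 1)) (hu1 : u 1 = 0)
    (hb₀ : ∀ r, 1 < r → u r ≠ 0 → 0 < b r) (hb : AntitoneOn b (Ici 1))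
    (hloc : ∀ r₀, 1 < r₀ → u r₀ ≠ 0 → c < sqRatio m u b r₀ →
      ∃ α k, 1 ≤ α ∧ α < r₀ ∧ k ≠ 0 ∧ ∀ r, α < r → u r = k * Q (r / α))
    (hne : ∃ r, 1 < r ∧ u r ≠ 0) :
    ∃ α k, 1 ≤ α ∧ (∀ r, α < r → u r = k * Q (r / α)) ∧ ∀ r ∈ Icc 1 α, u r = 0 := by
  have hloc' : ∀ r₁, 1 < r₁ → u r₁ ≠ 0 →
      ∃ α k, 1 ≤ α ∧ α < r₁ ∧ k ≠ 0 ∧ ∀ r, α < r → u r = k * Q (r / α) := by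
    intro r₁ hr₁ hur₁
    obtain ⟨r₀, h1, h2, h3, h4⟩ := exists_lt_sqRatio (m := m) hu hu1 hr₁ hur₁ (hb₀ r₁ hr₁ hur₁)
      (fun r h1 h2 => hb h1 hr₁.le h2) c
    obtain ⟨α, k, h5, h6, h7⟩ := hloc r₀ h1 h3 h4
    exact ⟨α, k, h5, h6.trans_le h2, h7⟩
  obtain ⟨r₁, hr₁, hur₁⟩ := hne
  obtain ⟨α, k, hα, -, -, hk⟩ := hloc' r₁ hr₁ hur₁
  have hα0 : 0 < α := by linarith
  have huα : u α = 0 := by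
    have h1 : Tendsto u (nhdsWithin α (Ioi α)) (nhds (u α)) :=
      (hu α hα).mono (Ioi_subset_Ici hα)
    have h2 : Tendsto (fun r => r / α) (nhdsWithin α (Ioi α)) (nhdsWithin 1 (Ioi 1)) := by
      refine tendsto_nhdsWithin_iff.mpr ⟨?_, ?_⟩
      · have : ContinuousAt (fun r => r / α) α := by fun_prop
        have := this.mono_left (nhdsWithin_le_nhds (s := Ioi α))
        simpa only [div_self hα0.ne'] using this
      · filter_upwards [self_mem_nhdsWithin] with r hr
        exact (one_lt_div hα0).mpr hr
    have h3 : Tendsto u (nhdsWithin α (Ioi α)) (nhds (k * 0)) := by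
      refine ((hQ.comp h2).const_mul k).congr' ?_
      filter_upwards [self_mem_nhdsWithin] with r hr
      exact (hk r hr).symm
    simpa using tendsto_nhds_unique h1 h3
  refine ⟨α, k, hα, hk, fun r hr => ?_⟩
  by_contra hur
  have hr1 : 1 < r := lt_of_le_of_ne hr.1 fun h => hur (h ▸ hu1)
  obtain ⟨β, l, hβ, hβr, hl, hβu⟩ := hloc' r hr1 hur
  have hβα : β < α := hβr.trans_le hr.2
  rw [hβu α hβα] at huα
  have hβ0 : 0 < β := by linarith
  exact mul_ne_zero hl (hQpos _ ((one_lt_div hβ0).mpr hβα)).ne' huα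

theorem eq_or_eq_neg_of_rescale {m : ℕ} (hm : 2 < m) {Q q u u' : ℝ → ℝ} {α k : ℝ}
    (hα : 1 ≤ α) (hk : ∀ r, α < r → u r = k * Q (r / α)) (h0 : ∀ r ∈ Icc 1 α, u r = 0)
    (hQ1 : Q 1 = 0)
    (hQd : ∀ r, 1 < r → HasDerivAt Q (q r) r) (hud : ∀ r, 1 < r → HasDerivAt u (u' r) r)
    (hint : IntegrableOn (fun r => u' r ^ 2 * r ^ 2) (Ioi 1))
    (hA : ∫ r in Ioi 1, u' r ^ 2 * r ^ 2 = ∫ r in Ioi 1, q r ^ 2 * r ^ 2)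
    (hA0 : 0 < ∫ r in Ioi 1, q r ^ 2 * r ^ 2)
    (hB0 : 0 < ∫ r in Ioi 1, (Q r ^ 2) ^ (m + 1) * r ^ 2)
    (hB : ∫ r in Ioi 1, (Q r ^ 2) ^ (m + 1) * r ^ 2 ≤ ∫ r in Ioi 1, (u r ^ 2) ^ (m + 1) * r ^ 2) :
    (∀ r ∈ Ici (1:ℝ), u r = Q r) ∨ (∀ r ∈ Ici (1:ℝ), u r = -Q r) := by
  have hα0 : 0 < α := by linarith
  have hsub : Ioi α ⊆ Ioi 1 := Ioi_subset_Ioi hα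
  have hscale : ∀ g : ℝ → ℝ, ∫ r in Ioi α, g (r / α) = α * ∫ r in Ioi 1, g r := by
    intro g
    have := integral_comp_mul_left_Ioi g α (inv_pos.mpr hα0)
    rw [inv_inv, inv_mul_cancel₀ hα0.ne', smul_eq_mul] at this
    rw [← this]
    simp only [div_eq_inv_mul]
  have hu' : ∀ r, α < r → u' r = k * (q (r / α) / α) := by
    intro r hr
    have h1 : 1 < r / α := (one_lt_div hα0).mpr hr
    have h2 := ((hQd _ h1).comp r ((hasDerivAt_id r).div_const α)).const_mul k
    refine (hud r (hα.trans_lt hr)).unique ((h2.congr_of_eventuallyEq ?_).congr_deriv ?_)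
    · filter_upwards [lt_mem_nhds hr] with s hs
      exact hk s hs
    · ring
  have hAu : k ^ 2 * α * ∫ r in Ioi 1, q r ^ 2 * r ^ 2 ≤ ∫ r in Ioi 1, u' r ^ 2 * r ^ 2 := by
    calc k ^ 2 * α * ∫ r in Ioi 1, q r ^ 2 * r ^ 2
        = ∫ r in Ioi α, k ^ 2 * (q (r / α) ^ 2 * (r / α) ^ 2) := by
          rw [integral_const_mul, hscale (fun r => q r ^ 2 * r ^ 2), mul_assoc]
      _ = ∫ r in Ioi α, u' r ^ 2 * r ^ 2 := by
          refine setIntegral_congr_fun measurableSet_Ioi fun r hr => ?_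
          simp only [hu' r hr]
          ring
      _ ≤ ∫ r in Ioi 1, u' r ^ 2 * r ^ 2 :=
          setIntegral_mono_set hint (ae_of_all _ fun r => by positivity) hsub.eventuallyLE
  have hBu : ∫ r in Ioi 1, (u r ^ 2) ^ (m + 1) * r ^ 2
      = (k ^ 2) ^ (m + 1) * α ^ 3 * ∫ r in Ioi 1, (Q r ^ 2) ^ (m + 1) * r ^ 2 := by
    calc ∫ r in Ioi 1, (u r ^ 2) ^ (m + 1) * r ^ 2
        = ∫ r in Ioi α, (u r ^ 2) ^ (m + 1) * r ^ 2 := by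
          refine setIntegral_eq_of_subset_of_forall_sdiff_eq_zero measurableSet_Ioi hsub ?_
          intro r hr
          have hr1 : 1 < r := hr.1
          rw [h0 r ⟨hr1.le, not_lt.mp hr.2⟩]
          simp
      _ = ∫ r in Ioi α, ((k ^ 2) ^ (m + 1) * α ^ 2) *
            ((Q (r / α) ^ 2) ^ (m + 1) * (r / α) ^ 2) := by
          refine setIntegral_congr_fun measurableSet_Ioi fun r hr => ?_
          simp only [hk r hr, mul_pow, div_pow]
          field_simp
      _ = _ := by
          rw [integral_const_mul, hscale (fun r => (Q r ^ 2) ^ (m + 1) * r ^ 2)]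
          ring
  rw [hA] at hAu
  rw [hBu] at hB
  have hκα : k ^ 2 * α ≤ 1 := (mul_le_iff_le_one_left hA0).mp hAu
  have hκB : 1 ≤ (k ^ 2) ^ (m + 1) * α ^ 3 := (le_mul_iff_one_le_left hB0).mp hB
  have hκ0 : 0 ≤ k ^ 2 := sq_nonneg k
  have hκ1 : k ^ 2 ≤ 1 := by nlinarith
  have hκ : k ^ 2 = 1 := by
    by_contra hne
    have h1 : (k ^ 2) ^ (m - 2) < 1 :=
      pow_lt_one₀ hκ0 (lt_of_le_of_ne hκ1 hne) (by omega)
    have h2 : (k ^ 2 * α) ^ 3 ≤ 1 := pow_le_one₀ (by positivity) hκα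
    have h3 : (k ^ 2) ^ (m + 1) * α ^ 3 = (k ^ 2) ^ (m - 2) * (k ^ 2 * α) ^ 3 := by
      rw [mul_pow, ← mul_assoc, ← pow_add, show m - 2 + 3 = m + 1 by omega]
    have h4 : 0 ≤ (k ^ 2) ^ (m - 2) := by positivity
    nlinarith [mul_le_mul_of_nonneg_left h2 h4]
  have hα1 : α = 1 := by
    rw [hκ] at hκα
    linarith
  subst hα1
  rcases sq_eq_one_iff.mp hκ with hk1 | hk1
  · left
    intro r hr
    rcases eq_or_lt_of_le (mem_Ici.mp hr) with h | h
    · rw [← h, h0 1 ⟨le_rfl, le_rfl⟩, hQ1]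
    · simp [hk r h, hk1]
  · right
    intro r hr
    rcases eq_or_lt_of_le (mem_Ici.mp hr) with h | h
    · rw [← h, h0 1 ⟨le_rfl, le_rfl⟩, hQ1, neg_zero]
    · simp [hk r h, hk1]

theorem sq_pow_eq_abs_pow (x : ℝ) (m : ℕ) : (x ^ 2) ^ (m + 1) = |x| ^ (2 * (m + 1)) := by
  rw [pow_mul, sq_abs]

theorem isGroundProfile_of_radialH10 {m : ℕ} (hm : 2 < m) {Q : ℝ → ℝ} (hQ : RadialH10 m Q)
    (hreg : ContDiffOn ℝ 2 Q (Ioi 1))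
    (heq : ∀ r : ℝ, 1 < r → deriv (deriv Q) r + (2 / r) * deriv Q r + |Q r| ^ (2 * m) * Q r = 0)
    (hpos : ∀ r : ℝ, 1 < r → 0 < Q r) :
    IsGroundProfile m Q (deriv Q) (fun r => ∫ t in Ioi r, (Q t ^ 2) ^ (m + 1) * t ^ 2) := by
  obtain ⟨hc, -, hd, hlim, hint, hint'⟩ := hQ
  simp only [← sq_pow_eq_abs_pow] at hint'
  have hder : ∀ r, 1 < r → HasDerivAt Q (deriv Q r) r := fun r hr =>
    (hd.differentiableAt (isOpen_Ioi.mem_nhds hr)).hasDerivAt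
  have hdd : DifferentiableOn ℝ (deriv Q) (Ioi 1) :=
    (hreg.deriv_of_isOpen isOpen_Ioi (m := 1) (by norm_num)).differentiableOn one_ne_zero
  refine ⟨hm, hder, fun r hr => ?_, hpos, fun r hr => ?_, hlim, tendsto_integral_Ioi_zero hint',
    tendsto_mul_sq_atTop hder hlim hint⟩
  · refine (hdd.differentiableAt (isOpen_Ioi.mem_nhds hr)).hasDerivAt.congr_deriv ?_
    have := heq r hr
    rw [abs_of_pos (hpos r hr)] at this
    rw [pow_succ (Q r) (2 * m)]
    linarith
  · have hcont : ContinuousOn (fun r => (Q r ^ 2) ^ (m + 1) * r ^ 2) (Ioi 1) := by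
      have := hc.mono Ioi_subset_Ici_self
      fun_prop
    refine (hasDerivAt_integral_Ioi hint' hcont hr).congr_deriv ?_
    rw [← pow_mul, show 2 * (m + 1) = 2 * m + 2 by ring]

theorem IsGroundProfile.tail_sub_eq_integral {m : ℕ} {Q q B : ℝ → ℝ}
    (h : IsGroundProfile m Q q B) (hint : IntegrableOn (fun r => q r ^ 2 * r ^ 2) (Ioi 1))
    {r : ℝ} (hr : 1 < r) : B r - r ^ 2 * Q r * q r = ∫ t in Ioi r, q t ^ 2 * t ^ 2 := by
  have hd : ∀ t, 1 < t →
      HasDerivAt (fun t => -(B t - t ^ 2 * q t * Q t)) (q t ^ 2 * t ^ 2) t := by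
    intro t ht
    refine ((h.hasDerivAt_tail t ht).sub
      ((h.hasDerivAt_flux ht).mul (h.hasDerivAt t ht))).neg.congr_deriv ?_
    ring
  obtain ⟨l, -, hl⟩ := h.tendsto_flux
  have hlim : Tendsto (fun t => -(B t - t ^ 2 * q t * Q t)) atTop (nhds 0) := by
    simpa using (h.tendsto_tail.sub (hl.mul h.tendsto_zero)).neg
  have := integral_Ioi_of_hasDerivAt_of_tendsto (a := r)
    (hd r hr).continuousAt.continuousWithinAt (fun t ht => hd t (hr.trans ht))
    (hint.mono_set (Ioi_subset_Ioi hr.le)) hlim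
  rw [this]
  ring

theorem antitoneOn_integral_Ioi {F : ℝ → ℝ} (hF : IntegrableOn F (Ioi 1)) (hF0 : ∀ r, 0 ≤ F r) :
    AntitoneOn (fun r => ∫ t in Ioi r, F t) (Ici 1) := fun _ hr _ _ hrs =>
  setIntegral_mono_set (hF.mono_set (Ioi_subset_Ioi hr)) (ae_of_all _ hF0)
    (Ioi_subset_Ioi hrs).eventuallyLE

theorem integral_Ioi_pos {F : ℝ → ℝ} (hF : IntegrableOn F (Ioi 1)) (hF0 : ∀ r, 0 ≤ F r)
    (hc : ContinuousOn F (Ioi 1)) {r : ℝ} (hr : 1 < r) (hFr : F r ≠ 0) :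
    0 < ∫ t in Ioi r, F t := by
  have h0 : ∀ r, 0 ≤ ∫ t in Ioi r, F t := fun r => integral_nonneg hF0
  refine lt_of_le_of_ne (h0 r) fun h => hFr ?_
  have hmin : IsLocalMin (fun r => ∫ t in Ioi r, F t) r :=
    Eventually.of_forall fun s => by
      simp only [← h]
      exact h0 s
  exact neg_eq_zero.mp (hmin.hasDerivAt_eq_zero (hasDerivAt_integral_Ioi hF hc hr))

theorem tendsto_integral_Ioi_nhdsGT_one {F : ℝ → ℝ} (hF : IntegrableOn F (Ioi 1)) :
    Tendsto (fun r => ∫ t in Ioi r, F t) (nhdsWithin 1 (Ioi 1)) (nhds (∫ t in Ioi 1, F t)) :=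
  (continuousOn_integral_Ioi hF 1 self_mem_Ici).mono Ioi_subset_Ici_self

/-- Uniqueness in the variational problem: a profile with the Dirichlet norm of the ground state
and at least its `L^(2m+2)` norm is the ground state up to sign. -/
theorem eq_or_eq_neg_of_integral_le {m : ℕ} (hm : 2 < m) {Q u : ℝ → ℝ} (hQ : RadialH10 m Q)
    (hreg : ContDiffOn ℝ 2 Q (Ioi 1))
    (heq : ∀ r : ℝ, 1 < r → deriv (deriv Q) r + (2 / r) * deriv Q r + |Q r| ^ (2 * m) * Q r = 0)
    (hpos : ∀ r : ℝ, 1 < r → 0 < Q r) (hu : RadialH10 m u)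
    (hA : ∫ r in Ioi 1, (deriv u r) ^ 2 * r ^ 2 = ∫ r in Ioi 1, (deriv Q r) ^ 2 * r ^ 2)
    (hB : ∫ r in Ioi 1, |Q r| ^ (2 * (m + 1)) * r ^ 2
      ≤ ∫ r in Ioi 1, |u r| ^ (2 * (m + 1)) * r ^ 2) :
    (∀ r ∈ Ici (1:ℝ), u r = Q r) ∨ (∀ r ∈ Ici (1:ℝ), u r = -Q r) := by
  have h := isGroundProfile_of_radialH10 hm hQ hreg heq hpos
  obtain ⟨hQc, hQ1, -, -, hQint, hQint'⟩ := hQ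
  obtain ⟨huc, hu1, hud, hulim, huint, huint'⟩ := hu
  simp only [← sq_pow_eq_abs_pow] at hB hQint' huint'
  have hud : ∀ r, 1 < r → HasDerivAt u (deriv u r) r := fun r hr =>
    (hud.differentiableAt (isOpen_Ioi.mem_nhds hr)).hasDerivAt
  have hF : ∀ {f : ℝ → ℝ}, ContinuousOn f (Ici 1) →
      ContinuousOn (fun r => (f r ^ 2) ^ (m + 1) * r ^ 2) (Ioi 1) := fun hf => by
    have := hf.mono Ioi_subset_Ici_self
    fun_prop
  have hF0 : ∀ (f : ℝ → ℝ) r, 0 ≤ (f r ^ 2) ^ (m + 1) * r ^ 2 := fun f r => by positivity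
  have hub : ∀ r, 1 < r → u r ≠ 0 → 0 < ∫ t in Ioi r, (u t ^ 2) ^ (m + 1) * t ^ 2 :=
    fun r hr hur => integral_Ioi_pos huint' (hF0 u) (hF huc) hr (by positivity)
  have hA0 : 0 < ∫ r in Ioi 1, (deriv Q r) ^ 2 * r ^ 2 := by
    have h1 := mul_sq_le_integral_Ioi h.hasDerivAt h.tendsto_zero hQint one_lt_two
    have h2 := h.pos 2 one_lt_two
    have h3 := antitoneOn_integral_Ioi hQint (fun r => by positivity) self_mem_Ici
      (mem_Ici.mpr one_le_two) one_le_two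
    have h4 : 0 < 2 * Q 2 ^ 2 := by positivity
    exact h4.trans_le (h1.trans h3)
  have hB0 : 0 < ∫ r in Ioi 1, (Q r ^ 2) ^ (m + 1) * r ^ 2 :=
    (h.tail_pos one_lt_two).trans_le (antitoneOn_integral_Ioi hQint' (hF0 Q) self_mem_Ici
      (mem_Ici.mpr one_le_two) one_le_two)
  have hQlim : Tendsto Q (nhdsWithin 1 (Ioi 1)) (nhds 0) := by
    have := (hQc 1 self_mem_Ici).mono Ioi_subset_Ici_self
    rwa [ContinuousWithinAt, hQ1] at this
  obtain ⟨ζ, ω, T, c, hcal, -, hT, hTr, hTd⟩ := h.exists_calibration hB0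
    (tendsto_integral_Ioi_nhdsGT_one hQint') hQlim
    ((tendsto_integral_Ioi_nhdsGT_one hQint).congr' (by
      filter_upwards [self_mem_nhdsWithin] with r hr
      exact (h.tail_sub_eq_integral hQint hr).symm))
    (fun r hr => by
      rw [h.tail_sub_eq_integral hQint hr]
      exact integral_nonneg fun t => by positivity)
  have hae := hcal.ae_eq_of_le huc hu1 (measurable_deriv u) hud hulim huint huint'
    (hB0.trans_le hB) (by
      rw [hA, ← mul_div_assoc, le_div_iff₀ hB0, mul_comm]
      exact mul_le_mul_of_nonneg_right hB (by positivity))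
  have hne : ∃ r, 1 < r ∧ u r ≠ 0 := by
    by_contra! hne
    refine (hB0.trans_le hB).ne' ?_
    rw [setIntegral_congr_fun measurableSet_Ioi (g := fun _ => 0) fun r hr => by
      simp [hne r hr]]
    simp
  obtain ⟨α, k, hα, hk, h0⟩ := exists_eq_rescale_of_local (m := m) (c := c) h.pos hQlim huc hu1
    hub (antitoneOn_integral_Ioi huint' (hF0 u))
    (fun r₀ h1 h2 h3 => h.exists_rescale hcal.continuous hT hTr hTd huc hu1 hud
      (fun r hr => hasDerivAt_integral_Ioi huint' (hF huc) hr) hae h1 h2 h3) hne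
  exact eq_or_eq_neg_of_rescale hm hα hk h0 hQ1 h.hasDerivAt hud huint hA hA0 hB0 hB

/-- At the ground-state energy level, data with the same Dirichlet norm as the
ground state `Q₀` must be `(±Q₀, 0)`. -/
theorem critical_element_at_threshold
    (m : ℕ) (hm : 2 < m) (Q0 : ℝ → ℝ)
    (hQ0mem : RadialH10 m Q0)
    (hQ0reg : ContDiffOn ℝ 2 Q0 (Ioi 1))
    (hQ0eq : ∀ r : ℝ, 1 < r →
      deriv (deriv Q0) r + (2 / r) * deriv Q0 r + |Q0 r| ^ (2 * m) * Q0 r = 0)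
    (hQ0pos : ∀ r : ℝ, 1 < r → 0 < Q0 r)
    (u0 u1 : ℝ → ℝ)
    (hu0mem : RadialH10 m u0)
    (hu1mem : IntegrableOn (fun r => (u1 r)^2 * r^2) (Ioi 1))
    (hE : energyRad m u0 u1 ≤ energyRad m Q0 (fun _ => 0))
    (hgrad : ∫ r in Ioi 1, (deriv u0 r)^2 * r^2
           = ∫ r in Ioi 1, (deriv Q0 r)^2 * r^2) :
    (∀ᵐ r ∂(volume.restrict (Ioi (1:ℝ))), u1 r = 0) ∧
    ((∀ r ∈ Ici (1:ℝ), u0 r = Q0 r) ∨ (∀ r ∈ Ici (1:ℝ), u0 r = -Q0 r)) := by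
  have hm0 : (0:ℝ) < m + 1 := by positivity
  have hE' : (m + 1) * ∫ r in Ioi 1, (u1 r)^2 * r^2 ≤
      (∫ r in Ioi 1, |u0 r| ^ (2 * (m + 1)) * r^2)
        - ∫ r in Ioi 1, |Q0 r| ^ (2 * (m + 1)) * r^2 := by
    simp only [energyRad] at hE
    have h1 := le_of_mul_le_mul_left hE (by positivity)
    rw [hgrad] at h1
    simp only [ne_eq, OfNat.ofNat_ne_zero, not_false_eq_true, zero_pow, zero_mul, integral_zero,
      mul_zero, add_zero] at h1
    field_simp at h1
    linarith
  have hu1 : 0 ≤ ∫ r in Ioi 1, (u1 r)^2 * r^2 := integral_nonneg fun r => by positivity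
  have hu1m : 0 ≤ ((m:ℝ) + 1) * ∫ r in Ioi 1, (u1 r)^2 * r^2 := mul_nonneg hm0.le hu1
  have hor := eq_or_eq_neg_of_integral_le hm hQ0mem hQ0reg hQ0eq hQ0pos hu0mem hgrad
    (by linarith)
  refine ⟨?_, hor⟩
  have hBeq : ∫ r in Ioi 1, |u0 r| ^ (2 * (m + 1)) * r^2
      = ∫ r in Ioi 1, |Q0 r| ^ (2 * (m + 1)) * r^2 := by
    refine setIntegral_congr_fun measurableSet_Ioi fun r hr => ?_
    rcases hor with h | h
    · simp only [h r (Ioi_subset_Ici_self hr)]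
    · simp only [h r (Ioi_subset_Ici_self hr), abs_neg]
  have hzero : ∫ r in Ioi 1, (u1 r)^2 * r^2 = 0 := by
    rw [hBeq, sub_self] at hE'
    exact (mul_eq_zero.mp (le_antisymm hE' hu1m)).resolve_left hm0.ne'
  have hae := (setIntegral_eq_zero_iff_of_nonneg_ae
    (ae_of_all _ fun r => by positivity) hu1mem).mp hzero
  filter_upwards [hae, ae_restrict_mem measurableSet_Ioi] with r hr hr1
  have hr0 : r ≠ 0 := by
    have : 1 < r := hr1
    positivity
  simpa [hr0] using hr
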